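/- Let 0<β<∞, let u be holomorphic on 𝔻 and φ a holomorphic self-map of 𝔻, and suppose uC_φ maps the Bloch space B = B^1 boundedly into Z_β. Then there exist constants c, C > 0 depending only on β (not on u and φ) such that c·M ≤ ‖uC_φ‖_e ≤ C·M, where ‖uC_φ‖_e is the essential norm of uC_φ : B → Z_β and M = max{ limsup_{|φ(z)|→1} (1-|z|²)^β |u''(z)| log(e/(1-|φ(z)|²)), limsup_{|φ(z)|→1} (1-|z|²)^β |2u'(z)φ'(z) + u(z)φ''(z)| / (1-|φ(z)|²), limsup_{|φ(z)|→1} (1-|z|²)^β |u(z)| |φ'(z)|² / (1-|φ(z)|²)² }. -/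

import Mathlib

open Complex Filter Set

noncomputable section

/-- The open unit disk in `ℂ`. -/
def unitDisk : Set ℂ := Metric.ball 0 1

/-- The weighted sup-norm `‖g‖_{ν_γ} = sup_{z ∈ 𝔻} (1-|z|²)^γ |g(z)|`. -/
def wnorm (γ : ℝ) (g : ℂ → ℂ) : ℝ :=
  sSup ((fun z => (1 - ‖z‖ ^ 2) ^ γ * ‖g z‖) '' unitDisk)

/-- Membership in the weighted Banach space `H^∞_{ν_β}`. -/
def MemWeighted (β : ℝ) (g : ℂ → ℂ) : Prop :=
  DifferentiableOn ℂ g unitDisk ∧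
    BddAbove ((fun z => (1 - ‖z‖ ^ 2) ^ β * ‖g z‖) '' unitDisk)

/-- Membership in the Bloch type space `B^α`. -/
def MemBloch (α : ℝ) (f : ℂ → ℂ) : Prop :=
  DifferentiableOn ℂ f unitDisk ∧
    BddAbove ((fun z => (1 - ‖z‖ ^ 2) ^ α * ‖deriv f z‖) '' unitDisk)

/-- The Bloch type norm `‖f‖_{B^α} = |f(0)| + sup_{z∈𝔻}(1-|z|²)^α |f'(z)|`. -/
def blochNorm (α : ℝ) (f : ℂ → ℂ) : ℝ :=
  ‖f 0‖ + wnorm α (deriv f)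

/-- Membership in the Zygmund type space `Z_β`. -/
def MemZygmund (β : ℝ) (f : ℂ → ℂ) : Prop :=
  DifferentiableOn ℂ f unitDisk ∧
    BddAbove ((fun z => (1 - ‖z‖ ^ 2) ^ β * ‖deriv (deriv f) z‖) '' unitDisk)

/-- The Zygmund type norm `‖f‖_{Z_β} = |f(0)| + |f'(0)| + sup_{z∈𝔻}(1-|z|²)^β |f''(z)|`. -/
def zygNorm (β : ℝ) (f : ℂ → ℂ) : ℝ :=
  ‖f 0‖ + ‖deriv f 0‖ + wnorm β (deriv (deriv f))

/-- The weighted composition operator `uC_φ f = u · (f ∘ φ)`. -/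
def wcomp (u φ f : ℂ → ℂ) : ℂ → ℂ := fun z => u z * f (φ z)

/-- `uC_φ` maps `B^α` boundedly into `Z_β`. -/
def BoundedBlochToZygmund (α β : ℝ) (u φ : ℂ → ℂ) : Prop :=
  (∀ f, MemBloch α f → MemZygmund β (wcomp u φ f)) ∧
    ∃ C > 0, ∀ f, MemBloch α f → zygNorm β (wcomp u φ f) ≤ C * blochNorm α f

/-- `uC_φ` maps `B^α` boundedly into `H^∞_{ν_β}`. -/
def BoundedBlochToWeighted (α β : ℝ) (u φ : ℂ → ℂ) : Prop :=
  (∀ f, MemBloch α f → MemWeighted β (wcomp u φ f)) ∧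
    ∃ C > 0, ∀ f, MemBloch α f → wnorm β (wcomp u φ f) ≤ C * blochNorm α f

/-- `uC_φ : B^α → Z_β` is compact: it is bounded and maps bounded sets of `B^α` to
totally bounded (equivalently, since `Z_β` is complete, relatively compact) subsets
of `Z_β`. -/
def CompactBlochToZygmund (α β : ℝ) (u φ : ℂ → ℂ) : Prop :=
  BoundedBlochToZygmund α β u φ ∧
    ∀ r : ℝ, ∀ ε : ℝ, 0 < ε → ∃ T : Finset (ℂ → ℂ),
      (∀ g ∈ T, MemZygmund β g) ∧
      ∀ f, MemBloch α f → blochNorm α f ≤ r →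
        ∃ g ∈ T, zygNorm β (fun z => wcomp u φ f z - g z) ≤ ε

/-- `uC_φ : B^α → H^∞_{ν_β}` is compact: it is bounded and maps bounded sets of `B^α`
to totally bounded (equivalently, relatively compact) subsets of `H^∞_{ν_β}`. -/
def CompactBlochToWeighted (α β : ℝ) (u φ : ℂ → ℂ) : Prop :=
  BoundedBlochToWeighted α β u φ ∧
    ∀ r : ℝ, ∀ ε : ℝ, 0 < ε → ∃ T : Finset (ℂ → ℂ),
      (∀ g ∈ T, MemWeighted β g) ∧
      ∀ f, MemBloch α f → blochNorm α f ≤ r →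
        ∃ g ∈ T, wnorm β (fun z => wcomp u φ f z - g z) ≤ ε

/-- A compact (linear, bounded, with totally bounded image of the unit ball) operator
from the subspace of `B^α` cut out by the predicate `P` into `Z_β`. -/
def IsCompactOpToZygmund (α β : ℝ) (P : (ℂ → ℂ) → Prop) (K : (ℂ → ℂ) → ℂ → ℂ) : Prop :=
  (∀ f g, P f → P g → ∀ a b : ℂ,
      K (fun z => a * f z + b * g z) = fun z => a * K f z + b * K g z) ∧
  (∀ f, P f → MemZygmund β (K f)) ∧
  (∃ C, ∀ f, P f → zygNorm β (K f) ≤ C * blochNorm α f) ∧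
  (∀ ε : ℝ, 0 < ε → ∃ T : Finset (ℂ → ℂ), (∀ g ∈ T, MemZygmund β g) ∧
      ∀ f, P f → blochNorm α f ≤ 1 → ∃ g ∈ T, zygNorm β (fun z => K f z - g z) ≤ ε)

/-- The essential norm of `uC_φ`, as an operator from the subspace of `B^α` cut out by
the predicate `P` into `Z_β`: the distance to the compact operators, the operator norm
being the supremum over the unit ball. -/
def essNormZ (α β : ℝ) (P : (ℂ → ℂ) → Prop) (u φ : ℂ → ℂ) : ℝ :=
  sInf {r | ∃ K, IsCompactOpToZygmund α β P K ∧
    r = sSup {s | ∃ f, P f ∧ blochNorm α f ≤ 1 ∧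
          s = zygNorm β (fun z => wcomp u φ f z - K f z)}}

/-- A compact (linear, bounded, with totally bounded image of the unit ball) operator
from `B^α` into `H^∞_{ν_β}`. -/
def IsCompactOpToWeighted (α β : ℝ) (K : (ℂ → ℂ) → ℂ → ℂ) : Prop :=
  (∀ f g, MemBloch α f → MemBloch α g → ∀ a b : ℂ,
      K (fun z => a * f z + b * g z) = fun z => a * K f z + b * K g z) ∧
  (∀ f, MemBloch α f → MemWeighted β (K f)) ∧
  (∃ C, ∀ f, MemBloch α f → wnorm β (K f) ≤ C * blochNorm α f) ∧
  (∀ ε : ℝ, 0 < ε → ∃ T : Finset (ℂ → ℂ), (∀ g ∈ T, MemWeighted β g) ∧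
      ∀ f, MemBloch α f → blochNorm α f ≤ 1 → ∃ g ∈ T, wnorm β (fun z => K f z - g z) ≤ ε)

/-- The essential norm of `uC_φ : B^α → H^∞_{ν_β}`. -/
def essNormW (α β : ℝ) (u φ : ℂ → ℂ) : ℝ :=
  sInf {r | ∃ K, IsCompactOpToWeighted α β K ∧
    r = sSup {s | ∃ f, MemBloch α f ∧ blochNorm α f ≤ 1 ∧
          s = wnorm β (fun z => wcomp u φ f z - K f z)}}

/-- `limsup_{|φ(z)|→1} F(z) = lim_{s→1⁻} sup {F z : z ∈ 𝔻, |φ z| > s}`.  Since the inner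
supremum is nonincreasing in `s`, the limit equals the infimum over `s ∈ [0,1)`; note
that `Real.sSup ∅ = 0`, matching the convention that the value is `0` when
`{z : |φ z| > s}` is empty for some `s < 1`. -/
def phiLimsup (φ : ℂ → ℂ) (F : ℂ → ℝ) : ℝ :=
  sInf ((fun s => sSup {y | ∃ z ∈ unitDisk, s < ‖φ z‖ ∧ y = F z}) '' Set.Ico (0:ℝ) 1)

open scoped Topology ComplexConjugate

section WeightedSup

lemma isOpen_unitDisk : IsOpen unitDisk := Metric.isOpen_ball

lemma mem_unitDisk {z : ℂ} : z ∈ unitDisk ↔ ‖z‖ < 1 := by simp [unitDisk]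

lemma zero_mem_unitDisk : (0 : ℂ) ∈ unitDisk := by simp [unitDisk]

lemma one_sub_sq_pos {z : ℂ} (hz : z ∈ unitDisk) : 0 < 1 - ‖z‖ ^ 2 := by
  have h := mem_unitDisk.1 hz
  nlinarith [norm_nonneg z]

lemma one_sub_sq_le_one (z : ℂ) : 1 - ‖z‖ ^ 2 ≤ 1 := by nlinarith [norm_nonneg z]

lemma weight_nonneg (γ : ℝ) {z : ℂ} (hz : z ∈ unitDisk) : 0 ≤ (1 - ‖z‖ ^ 2) ^ γ :=
  Real.rpow_nonneg (one_sub_sq_pos hz).le _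

lemma le_wnorm {γ : ℝ} {g : ℂ → ℂ}
    (hb : BddAbove ((fun z => (1 - ‖z‖ ^ 2) ^ γ * ‖g z‖) '' unitDisk)) {z : ℂ}
    (hz : z ∈ unitDisk) : (1 - ‖z‖ ^ 2) ^ γ * ‖g z‖ ≤ wnorm γ g :=
  le_csSup hb ⟨z, hz, rfl⟩

lemma wnorm_nonneg (γ : ℝ) (g : ℂ → ℂ) : 0 ≤ wnorm γ g := by
  apply Real.sSup_nonneg
  rintro _ ⟨z, hz, rfl⟩
  exact mul_nonneg (weight_nonneg γ hz) (norm_nonneg _)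

lemma wnorm_le {γ M : ℝ} {g : ℂ → ℂ}
    (h : ∀ z ∈ unitDisk, (1 - ‖z‖ ^ 2) ^ γ * ‖g z‖ ≤ M) : wnorm γ g ≤ M := by
  apply csSup_le (Set.Nonempty.image _ ⟨0, zero_mem_unitDisk⟩)
  rintro _ ⟨z, hz, rfl⟩
  exact h z hz

lemma bddAbove_weighted {γ M : ℝ} {g : ℂ → ℂ}
    (h : ∀ z ∈ unitDisk, (1 - ‖z‖ ^ 2) ^ γ * ‖g z‖ ≤ M) :
    BddAbove ((fun z => (1 - ‖z‖ ^ 2) ^ γ * ‖g z‖) '' unitDisk) := by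
  refine ⟨M, ?_⟩
  rintro _ ⟨z, hz, rfl⟩
  exact h z hz

lemma zygNorm_nonneg (β : ℝ) (f : ℂ → ℂ) : 0 ≤ zygNorm β f := by
  have := wnorm_nonneg β (deriv (deriv f))
  unfold zygNorm
  positivity

lemma blochNorm_nonneg (α : ℝ) (f : ℂ → ℂ) : 0 ≤ blochNorm α f := by
  have := wnorm_nonneg α (deriv f)
  unfold blochNorm
  positivity

end WeightedSup

section Holomorphic

variable {f g u φ : ℂ → ℂ} {z w : ℂ}

lemma differentiableAt_of_mem (hf : DifferentiableOn ℂ f unitDisk) (hz : z ∈ unitDisk) :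
    DifferentiableAt ℂ f z :=
  hf.differentiableAt (isOpen_unitDisk.mem_nhds hz)

lemma differentiableOn_deriv (hf : DifferentiableOn ℂ f unitDisk) :
    DifferentiableOn ℂ (deriv f) unitDisk :=
  hf.deriv isOpen_unitDisk

lemma deriv_deriv_eq {U : Set ℂ} (hU : IsOpen U) {f' : ℂ → ℂ} {a : ℂ}
    (hf : ∀ z ∈ U, HasDerivAt f (f' z) z) (hw : w ∈ U) (hf' : HasDerivAt f' a w) :
    deriv (deriv f) w = a := by
  have : deriv f =ᶠ[𝓝 w] f' := by
    filter_upwards [hU.mem_nhds hw] with z hz using (hf z hz).deriv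
  rw [this.deriv_eq, hf'.deriv]

lemma deriv_sub_of_mem (hf : DifferentiableOn ℂ f unitDisk) (hg : DifferentiableOn ℂ g unitDisk)
    (hz : z ∈ unitDisk) : deriv (fun z => f z - g z) z = deriv f z - deriv g z :=
  ((differentiableAt_of_mem hf hz).hasDerivAt.sub
    (differentiableAt_of_mem hg hz).hasDerivAt).deriv

lemma deriv_deriv_sub_of_mem (hf : DifferentiableOn ℂ f unitDisk)
    (hg : DifferentiableOn ℂ g unitDisk) (hz : z ∈ unitDisk) :
    deriv (deriv (fun z => f z - g z)) z = deriv (deriv f) z - deriv (deriv g) z :=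
  deriv_deriv_eq isOpen_unitDisk (fun _ hx => (differentiableAt_of_mem hf hx).hasDerivAt.sub
    (differentiableAt_of_mem hg hx).hasDerivAt) hz
    ((differentiableAt_of_mem (differentiableOn_deriv hf) hz).hasDerivAt.sub
      (differentiableAt_of_mem (differentiableOn_deriv hg) hz).hasDerivAt)

lemma hasDerivAt_wcomp (hu : DifferentiableOn ℂ u unitDisk) (hφ : DifferentiableOn ℂ φ unitDisk)
    (hm : MapsTo φ unitDisk unitDisk) (hf : DifferentiableOn ℂ f unitDisk) (hz : z ∈ unitDisk) :
    HasDerivAt (wcomp u φ f) (deriv u z * f (φ z) + u z * (deriv f (φ z) * deriv φ z)) z :=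
  (differentiableAt_of_mem hu hz).hasDerivAt.mul
    ((differentiableAt_of_mem hf (hm hz)).hasDerivAt.comp z
      (differentiableAt_of_mem hφ hz).hasDerivAt)

lemma deriv_deriv_wcomp (hu : DifferentiableOn ℂ u unitDisk)
    (hφ : DifferentiableOn ℂ φ unitDisk) (hm : MapsTo φ unitDisk unitDisk)
    (hf : DifferentiableOn ℂ f unitDisk) (hz : z ∈ unitDisk) :
    deriv (deriv (wcomp u φ f)) z = deriv (deriv u) z * f (φ z) +
      (2 * deriv u z * deriv φ z + u z * deriv (deriv φ) z) * deriv f (φ z) +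
      u z * deriv φ z ^ 2 * deriv (deriv f) (φ z) := by
  have hu1 := (differentiableAt_of_mem hu hz).hasDerivAt
  have hu2 := (differentiableAt_of_mem (differentiableOn_deriv hu) hz).hasDerivAt
  have hφ1 := (differentiableAt_of_mem hφ hz).hasDerivAt
  have hφ2 := (differentiableAt_of_mem (differentiableOn_deriv hφ) hz).hasDerivAt
  have hf1 := (differentiableAt_of_mem hf (hm hz)).hasDerivAt.comp z hφ1
  have hf2 := (differentiableAt_of_mem (differentiableOn_deriv hf) (hm hz)).hasDerivAt.comp z hφ1
  refine deriv_deriv_eq isOpen_unitDisk (fun _ hx => hasDerivAt_wcomp hu hφ hm hf hx) hz ?_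
  refine ((hu2.mul hf1).add (hu1.mul (hf2.mul hφ2))).congr_deriv ?_
  simp only [Pi.mul_apply, Function.comp]
  ring

end Holomorphic

section Spaces

variable {f g u φ : ℂ → ℂ} {z : ℂ} {β : ℝ}

lemma MemZygmund.sub (hf : MemZygmund β f) (hg : MemZygmund β g) :
    MemZygmund β (fun z => f z - g z) := by
  refine ⟨hf.1.sub hg.1, bddAbove_weighted
    (M := wnorm β (deriv (deriv f)) + wnorm β (deriv (deriv g))) fun z hz => ?_⟩
  rw [deriv_deriv_sub_of_mem hf.1 hg.1 hz]
  have h1 := le_wnorm hf.2 hz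
  have h2 := le_wnorm hg.2 hz
  have h3 := mul_le_mul_of_nonneg_left (norm_sub_le (deriv (deriv f) z) (deriv (deriv g) z))
    (weight_nonneg β hz)
  linarith

lemma zygNorm_sub_le (hf : MemZygmund β f) (hg : MemZygmund β g) :
    zygNorm β (fun z => f z - g z) ≤ zygNorm β f + zygNorm β g := by
  have h0 := norm_sub_le (f 0) (g 0)
  have h1 : ‖deriv (fun z => f z - g z) 0‖ ≤ ‖deriv f 0‖ + ‖deriv g 0‖ := by
    rw [deriv_sub_of_mem hf.1 hg.1 zero_mem_unitDisk]
    exact norm_sub_le _ _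
  have h2 : wnorm β (deriv (deriv (fun z => f z - g z))) ≤
      wnorm β (deriv (deriv f)) + wnorm β (deriv (deriv g)) := by
    refine wnorm_le fun z hz => ?_
    rw [deriv_deriv_sub_of_mem hf.1 hg.1 hz]
    have h1 := le_wnorm hf.2 hz
    have h2 := le_wnorm hg.2 hz
    have h3 := mul_le_mul_of_nonneg_left (norm_sub_le (deriv (deriv f) z) (deriv (deriv g) z))
      (weight_nonneg β hz)
    linarith
  unfold zygNorm
  linarith

lemma MemZygmund.weight_mul_le (hf : MemZygmund β f) (hz : z ∈ unitDisk) :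
    (1 - ‖z‖ ^ 2) ^ β * ‖deriv (deriv f) z‖ ≤ zygNorm β f := by
  have := le_wnorm hf.2 hz
  unfold zygNorm
  linarith [norm_nonneg (f 0), norm_nonneg (deriv f 0)]

lemma MemBloch.norm_deriv_le {C : ℝ} (hf : MemBloch 1 f) (hC : blochNorm 1 f ≤ C)
    (hz : z ∈ unitDisk) : ‖deriv f z‖ ≤ C / (1 - ‖z‖ ^ 2) := by
  have h := le_wnorm hf.2 hz
  rw [Real.rpow_one] at h
  rw [le_div_iff₀ (one_sub_sq_pos hz), mul_comm]
  unfold blochNorm at hC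
  linarith [norm_nonneg (f 0)]

lemma norm_zero_le_blochNorm (f : ℂ → ℂ) : ‖f 0‖ ≤ blochNorm 1 f := by
  have := wnorm_nonneg 1 (deriv f)
  unfold blochNorm
  linarith

lemma blochNorm_le {A B : ℝ} (h0 : ‖f 0‖ ≤ A)
    (h : ∀ z ∈ unitDisk, (1 - ‖z‖ ^ 2) * ‖deriv f z‖ ≤ B) : blochNorm 1 f ≤ A + B :=
  add_le_add h0 (wnorm_le fun z hz => by rw [Real.rpow_one]; exact h z hz)

lemma memBloch_of_le {B : ℝ} (hf : DifferentiableOn ℂ f unitDisk)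
    (h : ∀ z ∈ unitDisk, (1 - ‖z‖ ^ 2) * ‖deriv f z‖ ≤ B) : MemBloch 1 f :=
  ⟨hf, bddAbove_weighted fun z hz => by rw [Real.rpow_one]; exact h z hz⟩

lemma MemBloch.const_mul (hf : MemBloch 1 f) (c : ℂ) : MemBloch 1 (fun z => c * f z) := by
  refine memBloch_of_le (hf.1.const_mul c) (B := ‖c‖ * wnorm 1 (deriv f)) fun z hz => ?_
  have h := le_wnorm hf.2 hz
  rw [Real.rpow_one] at h
  rw [deriv_const_mul_field, norm_mul, mul_left_comm]
  gcongr

lemma blochNorm_const_mul_le (hf : MemBloch 1 f) (c : ℂ) :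
    blochNorm 1 (fun z => c * f z) ≤ ‖c‖ * blochNorm 1 f := by
  rw [blochNorm.eq_def _ f, mul_add]
  refine blochNorm_le (norm_mul _ _).le fun z hz => ?_
  have h := le_wnorm hf.2 hz
  rw [Real.rpow_one] at h
  rw [deriv_const_mul_field, norm_mul, mul_left_comm]
  gcongr

lemma MemBloch.sub (hf : MemBloch 1 f) (hg : MemBloch 1 g) :
    MemBloch 1 (fun z => f z - g z) := by
  refine memBloch_of_le (hf.1.sub hg.1) (B := blochNorm 1 f + blochNorm 1 g) fun z hz => ?_
  rw [deriv_sub_of_mem hf.1 hg.1 hz]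
  have hp := one_sub_sq_pos hz
  have h1 := hf.norm_deriv_le le_rfl hz
  have h2 := hg.norm_deriv_le le_rfl hz
  rw [le_div_iff₀ hp] at h1 h2
  have h3 := mul_le_mul_of_nonneg_left (norm_sub_le (deriv f z) (deriv g z)) hp.le
  linarith

/-- The density `(1-|z|²)^β |(uC_φ f)''(z)|` is controlled by the three symbols. -/
lemma weight_mul_deriv_deriv_wcomp_le (hu : DifferentiableOn ℂ u unitDisk)
    (hφ : DifferentiableOn ℂ φ unitDisk) (hm : MapsTo φ unitDisk unitDisk)
    (hf : DifferentiableOn ℂ f unitDisk) (hz : z ∈ unitDisk) :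
    (1 - ‖z‖ ^ 2) ^ β * ‖deriv (deriv (wcomp u φ f)) z‖ ≤
      (1 - ‖z‖ ^ 2) ^ β * ‖deriv (deriv u) z‖ * ‖f (φ z)‖ +
      (1 - ‖z‖ ^ 2) ^ β * ‖2 * deriv u z * deriv φ z + u z * deriv (deriv φ) z‖ *
        ‖deriv f (φ z)‖ +
      (1 - ‖z‖ ^ 2) ^ β * (‖u z‖ * ‖deriv φ z‖ ^ 2) * ‖deriv (deriv f) (φ z)‖ := by
  rw [deriv_deriv_wcomp hu hφ hm hf hz]
  have h := mul_le_mul_of_nonneg_left (norm_add₃_le (a := deriv (deriv u) z * f (φ z))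
    (b := (2 * deriv u z * deriv φ z + u z * deriv (deriv φ) z) * deriv f (φ z))
    (c := u z * deriv φ z ^ 2 * deriv (deriv f) (φ z))) (weight_nonneg β hz)
  simp only [norm_mul, norm_pow] at h ⊢
  linarith

end Spaces

section TestFunctions

/-- The involutive-up-to-sign disk automorphism `z ↦ (z - w) / (1 - conj w * z)`. -/
def diskMoebius (w z : ℂ) : ℂ := (z - w) / (1 - conj w * z)

/-- The logarithmic test function `z ↦ log (e / (1 - conj w * z))`. -/
def logTest (w z : ℂ) : ℂ := 1 - Complex.log (1 - conj w * z)

/-- The open neighbourhood of the closed unit disk on which the test functions are holomorphic. -/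
def testDomain (w : ℂ) : Set ℂ := {z | ‖conj w * z‖ < 1}

variable {w z : ℂ}

lemma isOpen_testDomain (w : ℂ) : IsOpen (testDomain w) :=
  isOpen_lt (by fun_prop) continuous_const

lemma closedBall_subset_testDomain (hw : w ∈ unitDisk) :
    Metric.closedBall 0 1 ⊆ testDomain w := by
  intro z hz
  have hz' : ‖z‖ ≤ 1 := by simpa using hz
  have hw' := mem_unitDisk.1 hw
  simp only [testDomain, mem_ofPred_eq, norm_mul, RCLike.norm_conj]
  nlinarith [norm_nonneg z, norm_nonneg w]

lemma unitDisk_subset_testDomain (hw : w ∈ unitDisk) : unitDisk ⊆ testDomain w :=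
  Metric.ball_subset_closedBall.trans (closedBall_subset_testDomain hw)

lemma one_sub_mem_slitPlane (hz : z ∈ testDomain w) : 1 - conj w * z ∈ slitPlane := by
  have h : (conj w * z).re < 1 := (Complex.re_le_norm _).trans_lt hz
  exact Or.inl (by simpa only [sub_re, one_re, sub_pos] using h)

lemma one_sub_ne_zero (hz : z ∈ testDomain w) : 1 - conj w * z ≠ 0 :=
  slitPlane_ne_zero (one_sub_mem_slitPlane hz)

lemma hasDerivAt_one_sub (w z : ℂ) : HasDerivAt (fun z => 1 - conj w * z) (-conj w) z := by
  simpa using ((hasDerivAt_id z).const_mul (conj w)).const_sub 1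

lemma hasDerivAt_diskMoebius (hz : z ∈ testDomain w) :
    HasDerivAt (diskMoebius w) ((1 - conj w * w) / (1 - conj w * z) ^ 2) z := by
  refine (((hasDerivAt_id z).sub_const w).div (hasDerivAt_one_sub w z) (one_sub_ne_zero hz)).congr_deriv ?_
  simp only [id]
  ring

lemma hasDerivAt_diskMoebius_deriv (hz : z ∈ testDomain w) :
    HasDerivAt (fun z => (1 - conj w * w) / (1 - conj w * z) ^ 2)
      (2 * conj w * (1 - conj w * w) / (1 - conj w * z) ^ 3) z := by
  have h := one_sub_ne_zero hz
  refine (((hasDerivAt_const z (1 - conj w * w)).div ((hasDerivAt_one_sub w z).pow 2)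
    (pow_ne_zero 2 h))).congr_deriv ?_
  simp only [Pi.pow_apply]
  field_simp
  ring

lemma hasDerivAt_logTest (hz : z ∈ testDomain w) :
    HasDerivAt (logTest w) (conj w / (1 - conj w * z)) z := by
  refine (((hasDerivAt_one_sub w z).clog (one_sub_mem_slitPlane hz)).const_sub 1).congr_deriv ?_
  ring

lemma hasDerivAt_logTest_deriv (hz : z ∈ testDomain w) :
    HasDerivAt (fun z => conj w / (1 - conj w * z)) (conj w ^ 2 / (1 - conj w * z) ^ 2) z := by
  refine (((hasDerivAt_const z (conj w)).div (hasDerivAt_one_sub w z) (one_sub_ne_zero hz))).congr_deriv ?_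
  ring

lemma hasDerivAt_diskMoebius_sq (hz : z ∈ testDomain w) :
    HasDerivAt (fun z => diskMoebius w z ^ 2)
      (2 * diskMoebius w z * ((1 - conj w * w) / (1 - conj w * z) ^ 2)) z := by
  exact ((hasDerivAt_diskMoebius hz).pow 2).congr_deriv (by simp)

lemma conj_mul_self_eq (w : ℂ) : conj w * w = ((‖w‖ ^ 2 : ℝ) : ℂ) := by
  rw [mul_comm, mul_conj, normSq_eq_norm_sq]

lemma one_sub_conj_mul_self (w : ℂ) : 1 - conj w * w = ((1 - ‖w‖ ^ 2 : ℝ) : ℂ) := by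
  rw [conj_mul_self_eq]
  push_cast
  ring

lemma norm_one_sub_conj_mul_self (hw : w ∈ unitDisk) : ‖1 - conj w * w‖ = 1 - ‖w‖ ^ 2 := by
  rw [one_sub_conj_mul_self, norm_real, Real.norm_of_nonneg (one_sub_sq_pos hw).le]

lemma diskMoebius_self (w : ℂ) : diskMoebius w w = 0 := by simp [diskMoebius]

lemma deriv_diskMoebius_self (hw : w ∈ unitDisk) :
    ‖deriv (diskMoebius w) w‖ = 1 / (1 - ‖w‖ ^ 2) := by
  have h := one_sub_sq_pos hw
  rw [(hasDerivAt_diskMoebius (unitDisk_subset_testDomain hw hw)).deriv, norm_div, norm_pow,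
    norm_one_sub_conj_mul_self hw]
  field_simp

lemma deriv_deriv_diskMoebius_self_le (hw : w ∈ unitDisk) :
    ‖deriv (deriv (diskMoebius w)) w‖ ≤ 2 / (1 - ‖w‖ ^ 2) ^ 2 := by
  have h := one_sub_sq_pos hw
  have hU := unitDisk_subset_testDomain hw hw
  rw [deriv_deriv_eq (isOpen_testDomain w) (fun _ hx => hasDerivAt_diskMoebius hx) hU
    (hasDerivAt_diskMoebius_deriv hU), norm_div, norm_pow, norm_mul,
    norm_one_sub_conj_mul_self hw, norm_mul, RCLike.norm_conj, Complex.norm_ofNat]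
  rw [div_le_div_iff₀ (by positivity) (by positivity)]
  have := mem_unitDisk.1 hw
  have h3 : 0 < (1 - ‖w‖ ^ 2) ^ 3 := by positivity
  nlinarith

lemma deriv_diskMoebius_sq_self (hw : w ∈ unitDisk) :
    deriv (fun z => diskMoebius w z ^ 2) w = 0 := by
  rw [(hasDerivAt_diskMoebius_sq (unitDisk_subset_testDomain hw hw)).deriv, diskMoebius_self]
  simp

lemma deriv_deriv_diskMoebius_sq_self (hw : w ∈ unitDisk) :
    ‖deriv (deriv (fun z => diskMoebius w z ^ 2)) w‖ = 2 / (1 - ‖w‖ ^ 2) ^ 2 := by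
  have h := one_sub_sq_pos hw
  have hU := unitDisk_subset_testDomain hw hw
  rw [deriv_deriv_eq (isOpen_testDomain w) (fun _ hx => hasDerivAt_diskMoebius_sq hx) hU
    (((hasDerivAt_diskMoebius hU).const_mul 2).mul (hasDerivAt_diskMoebius_deriv hU)),
    diskMoebius_self]
  simp only [norm_mul, norm_div, norm_pow, norm_one_sub_conj_mul_self hw, Complex.norm_ofNat,
    mul_zero, zero_mul, add_zero]
  field_simp

lemma norm_logTest_self (hw : w ∈ unitDisk) :
    ‖logTest w w‖ = Real.log (Real.exp 1 / (1 - ‖w‖ ^ 2)) := by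
  have h := one_sub_sq_pos hw
  have h1 : Real.log (1 - ‖w‖ ^ 2) ≤ 0 := Real.log_nonpos h.le (one_sub_sq_le_one w)
  rw [Real.log_div (Real.exp_pos 1).ne' h.ne', Real.log_exp, logTest, one_sub_conj_mul_self,
    ← ofReal_log h.le, ← ofReal_one, ← ofReal_sub, norm_real, Real.norm_of_nonneg (by linarith)]

lemma norm_deriv_logTest_self_le (hw : w ∈ unitDisk) :
    ‖deriv (logTest w) w‖ ≤ 1 / (1 - ‖w‖ ^ 2) := by
  have h := one_sub_sq_pos hw
  rw [(hasDerivAt_logTest (unitDisk_subset_testDomain hw hw)).deriv, norm_div,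
    norm_one_sub_conj_mul_self hw, RCLike.norm_conj]
  gcongr
  exact (mem_unitDisk.1 hw).le

lemma norm_deriv_deriv_logTest_self_le (hw : w ∈ unitDisk) :
    ‖deriv (deriv (logTest w)) w‖ ≤ 1 / (1 - ‖w‖ ^ 2) ^ 2 := by
  have h := one_sub_sq_pos hw
  have hU := unitDisk_subset_testDomain hw hw
  rw [deriv_deriv_eq (isOpen_testDomain w) (fun _ hx => hasDerivAt_logTest hx) hU
    (hasDerivAt_logTest_deriv hU), norm_div, norm_pow, norm_pow,
    norm_one_sub_conj_mul_self hw, RCLike.norm_conj]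
  gcongr
  exact pow_le_one₀ (norm_nonneg _) (mem_unitDisk.1 hw).le

lemma one_sub_norm_mul_le (w z : ℂ) : 1 - ‖w‖ * ‖z‖ ≤ ‖1 - conj w * z‖ := by
  simpa using norm_sub_norm_le (1 : ℂ) (conj w * z)

lemma mul_one_sub_sq_le (hw : w ∈ unitDisk) (hz : z ∈ unitDisk) :
    (1 - ‖z‖ ^ 2) * (1 - ‖w‖ ^ 2) ≤ ‖1 - conj w * z‖ ^ 2 := by
  have h1 := mem_unitDisk.1 hw
  have h2 := mem_unitDisk.1 hz
  have h3 : 0 ≤ 1 - ‖w‖ * ‖z‖ := by nlinarith [norm_nonneg w, norm_nonneg z]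
  have h4 := pow_le_pow_left₀ h3 (one_sub_norm_mul_le w z) 2
  nlinarith [sq_nonneg (‖w‖ - ‖z‖)]

lemma norm_diskMoebius_le_one (hw : w ∈ unitDisk) (hz : z ∈ unitDisk) :
    ‖diskMoebius w z‖ ≤ 1 := by
  have h1 := one_sub_sq_pos hw
  have h2 := one_sub_sq_pos hz
  have h3 : ‖1 - conj w * z‖ ^ 2 - ‖z - w‖ ^ 2 = (1 - ‖z‖ ^ 2) * (1 - ‖w‖ ^ 2) := by
    simp only [← normSq_eq_norm_sq, normSq_apply, sub_re, sub_im, mul_re, mul_im, one_re, one_im,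
      conj_re, conj_im]
    ring
  rw [diskMoebius, norm_div]
  apply div_le_one_of_le₀ _ (norm_nonneg _)
  exact le_of_sq_le_sq (by nlinarith [mul_pos h1 h2]) (norm_nonneg _)

lemma weight_mul_deriv_diskMoebius_le (hw : w ∈ unitDisk) (hz : z ∈ unitDisk) :
    (1 - ‖z‖ ^ 2) * ‖(1 - conj w * w) / (1 - conj w * z) ^ 2‖ ≤ 1 := by
  have h := norm_pos_iff.2 (one_sub_ne_zero (unitDisk_subset_testDomain hw hz))
  rw [norm_div, norm_pow, norm_one_sub_conj_mul_self hw, ← mul_div_assoc,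
    div_le_one (by positivity)]
  exact mul_one_sub_sq_le hw hz

lemma differentiableOn_diskMoebius (w : ℂ) : DifferentiableOn ℂ (diskMoebius w) (testDomain w) :=
  fun _ hz => (hasDerivAt_diskMoebius hz).differentiableAt.differentiableWithinAt

lemma differentiableOn_diskMoebius_sq (w : ℂ) :
    DifferentiableOn ℂ (fun z => diskMoebius w z ^ 2) (testDomain w) :=
  (differentiableOn_diskMoebius w).pow 2

lemma differentiableOn_logTest (w : ℂ) : DifferentiableOn ℂ (logTest w) (testDomain w) :=
  fun _ hz => (hasDerivAt_logTest hz).differentiableAt.differentiableWithinAt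

lemma weight_mul_deriv_diskMoebius_le' (hw : w ∈ unitDisk) (hz : z ∈ unitDisk) :
    (1 - ‖z‖ ^ 2) * ‖deriv (diskMoebius w) z‖ ≤ 2 := by
  rw [(hasDerivAt_diskMoebius (unitDisk_subset_testDomain hw hz)).deriv]
  linarith [weight_mul_deriv_diskMoebius_le hw hz]

lemma weight_mul_deriv_diskMoebius_sq_le (hw : w ∈ unitDisk) (hz : z ∈ unitDisk) :
    (1 - ‖z‖ ^ 2) * ‖deriv (fun z => diskMoebius w z ^ 2) z‖ ≤ 2 := by
  rw [(hasDerivAt_diskMoebius_sq (unitDisk_subset_testDomain hw hz)).deriv, norm_mul, norm_mul,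
    Complex.norm_ofNat, mul_left_comm]
  have h1 := weight_mul_deriv_diskMoebius_le hw hz
  have h2 := norm_diskMoebius_le_one hw hz
  have h3 := one_sub_sq_pos hz
  calc 2 * ‖diskMoebius w z‖ * ((1 - ‖z‖ ^ 2) * ‖(1 - conj w * w) / (1 - conj w * z) ^ 2‖)
      ≤ 2 * 1 * 1 := by gcongr
    _ = 2 := by norm_num

lemma weight_mul_deriv_logTest_le (hw : w ∈ unitDisk) (hz : z ∈ unitDisk) :
    (1 - ‖z‖ ^ 2) * ‖deriv (logTest w) z‖ ≤ 2 := by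
  have h := norm_pos_iff.2 (one_sub_ne_zero (unitDisk_subset_testDomain hw hz))
  rw [(hasDerivAt_logTest (unitDisk_subset_testDomain hw hz)).deriv, norm_div, RCLike.norm_conj,
    ← mul_div_assoc, div_le_iff₀ h]
  have h1 := mem_unitDisk.1 hw
  have h2 := mem_unitDisk.1 hz
  have h3 := one_sub_norm_mul_le w z
  have h4 := one_sub_sq_pos hz
  nlinarith [norm_nonneg z, norm_nonneg w]

lemma memBloch_of_testDomain {f : ℂ → ℂ} (hw : w ∈ unitDisk)
    (hf : DifferentiableOn ℂ f (testDomain w))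
    (h : ∀ z ∈ unitDisk, (1 - ‖z‖ ^ 2) * ‖deriv f z‖ ≤ 2) : MemBloch 1 f :=
  memBloch_of_le (hf.mono (unitDisk_subset_testDomain hw)) h

lemma blochNorm_diskMoebius_le (hw : w ∈ unitDisk) : blochNorm 1 (diskMoebius w) ≤ 3 :=
  (blochNorm_le (norm_diskMoebius_le_one hw zero_mem_unitDisk) fun _ hz =>
    weight_mul_deriv_diskMoebius_le' hw hz).trans (by norm_num)

lemma blochNorm_diskMoebius_sq_le (hw : w ∈ unitDisk) :
    blochNorm 1 (fun z => diskMoebius w z ^ 2) ≤ 3 := by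
  refine (blochNorm_le (A := 1) ?_ fun _ hz =>
    weight_mul_deriv_diskMoebius_sq_le hw hz).trans (by norm_num)
  rw [norm_pow]
  exact pow_le_one₀ (norm_nonneg _) (norm_diskMoebius_le_one hw zero_mem_unitDisk)

lemma blochNorm_logTest_le (hw : w ∈ unitDisk) : blochNorm 1 (logTest w) ≤ 3 :=
  (blochNorm_le (A := 1) (by simp [logTest]) fun _ hz =>
    weight_mul_deriv_logTest_le hw hz).trans (by norm_num)

lemma exists_jet_bound {f : ℂ → ℂ} {U : Set ℂ} (hU : IsOpen U) (hs : Metric.closedBall 0 1 ⊆ U)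
    (hf : DifferentiableOn ℂ f U) :
    ∃ B, ∀ z ∈ unitDisk, ‖f z‖ ≤ B ∧ ‖deriv f z‖ ≤ B ∧ ‖deriv (deriv f) z‖ ≤ B := by
  have hK := isCompact_closedBall (0 : ℂ) 1
  obtain ⟨B₀, h₀⟩ := hK.exists_bound_of_continuousOn (hf.continuousOn.mono hs)
  obtain ⟨B₁, h₁⟩ := hK.exists_bound_of_continuousOn ((hf.deriv hU).continuousOn.mono hs)
  obtain ⟨B₂, h₂⟩ := hK.exists_bound_of_continuousOn (((hf.deriv hU).deriv hU).continuousOn.mono hs)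
  refine ⟨max B₀ (max B₁ B₂), fun z hz => ?_⟩
  have hz' := Metric.ball_subset_closedBall hz
  exact ⟨(h₀ z hz').trans (le_max_left _ _),
    (h₁ z hz').trans ((le_max_left _ _).trans (le_max_right _ _)),
    (h₂ z hz').trans ((le_max_right _ _).trans (le_max_right _ _))⟩

end TestFunctions

section Growth

variable {f g : ℂ → ℂ} {w : ℂ}

lemma norm_le_of_blochNorm_le_one (hf : MemBloch 1 f) (hn : blochNorm 1 f ≤ 1)
    (hw : w ∈ unitDisk) : ‖f w‖ ≤ 1 - Real.log (1 - ‖w‖) := by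
  have hw1 := mem_unitDisk.1 hw
  have hmem : ∀ t ∈ Icc (0 : ℝ) 1, (t : ℂ) * w ∈ unitDisk := by
    intro t ht
    rw [mem_unitDisk, norm_mul, norm_real, Real.norm_of_nonneg ht.1]
    nlinarith [norm_nonneg w, ht.2]
  have hpos : ∀ t ∈ Icc (0 : ℝ) 1, 0 < 1 - t * ‖w‖ := by
    intro t ht
    nlinarith [norm_nonneg w, ht.1, ht.2]
  have hd : ∀ t ∈ Icc (0 : ℝ) 1,
      HasDerivAt (fun t : ℝ => f (t * w)) (deriv f (t * w) * w) t := by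
    intro t ht
    have h1 : HasDerivAt (fun s : ℂ => f (s * w)) (deriv f (t * w) * w) (t : ℂ) := by
      have h2 : HasDerivAt (fun s : ℂ => s * w) w (t : ℂ) := by
        simpa using (hasDerivAt_id (t : ℂ)).mul_const w
      exact HasDerivAt.comp (t : ℂ) (differentiableAt_of_mem hf.1 (hmem t ht)).hasDerivAt h2
    exact h1.comp_ofReal
  have hB : ∀ t ∈ Icc (0 : ℝ) 1, HasDerivAt (fun t : ℝ => 1 - Real.log (1 - t * ‖w‖))
      (‖w‖ / (1 - t * ‖w‖)) t := by
    intro t ht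
    have h1 : HasDerivAt (fun t : ℝ => 1 - t * ‖w‖) (-‖w‖) t := by
      simpa using ((hasDerivAt_id t).mul_const ‖w‖).const_sub 1
    exact ((h1.log (hpos t ht).ne').const_sub 1).congr_deriv (by ring)
  have key := image_norm_le_of_norm_deriv_right_le_deriv_boundary'
    (fun t ht => (hd t ht).continuousAt.continuousWithinAt)
    (fun t ht => (hd t (Ico_subset_Icc_self ht)).hasDerivWithinAt)
    (by simpa using (norm_zero_le_blochNorm f).trans hn)
    (fun t ht => (hB t ht).continuousAt.continuousWithinAt)
    (fun t ht => (hB t (Ico_subset_Icc_self ht)).hasDerivWithinAt) ?_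
    (right_mem_Icc.2 zero_le_one)
  · simpa using key
  · intro t ht
    have ht' := Ico_subset_Icc_self ht
    have h1 := hf.norm_deriv_le hn (hmem t ht')
    have h2 := hpos t ht'
    have h3 : 1 - t * ‖w‖ ≤ 1 - ‖(t : ℂ) * w‖ ^ 2 := by
      rw [norm_mul, norm_real, Real.norm_of_nonneg ht.1]
      nlinarith [mul_nonneg ht.1 (norm_nonneg w)]
    rw [norm_mul, div_eq_mul_one_div, mul_comm ‖w‖]
    gcongr
    exact h1.trans (one_div_le_one_div_of_le h2 h3)

lemma norm_le_log_of_blochNorm_le_one (hf : MemBloch 1 f) (hn : blochNorm 1 f ≤ 1)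
    (hw : w ∈ unitDisk) : ‖f w‖ ≤ 2 * Real.log (Real.exp 1 / (1 - ‖w‖ ^ 2)) := by
  refine (norm_le_of_blochNorm_le_one hf hn hw).trans ?_
  have h := one_sub_sq_pos hw
  have h1 : Real.log (1 - ‖w‖ ^ 2) ≤ 0 := Real.log_nonpos h.le (one_sub_sq_le_one w)
  have h2 : Real.log (1 - ‖w‖ ^ 2) ≤ Real.log 2 + Real.log (1 - ‖w‖) := by
    have hw1 := mem_unitDisk.1 hw
    rw [← Real.log_mul (by norm_num) (by linarith)]
    exact Real.log_le_log h (by nlinarith [norm_nonneg w])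
  have h3 : Real.log 2 ≤ 1 := by linarith [Real.log_two_lt_d9]
  rw [Real.log_div (Real.exp_pos 1).ne' h.ne', Real.log_exp]
  linarith

lemma norm_deriv_le_of_forall_closedBall {s t A : ℝ} (hf : DifferentiableOn ℂ f unitDisk)
    (hst : s < t) (ht : t < 1) (hA : ∀ z, ‖z‖ ≤ t → ‖f z‖ ≤ A) (hw : ‖w‖ ≤ s) :
    ‖deriv f w‖ ≤ A / (t - s) := by
  have hsub : Metric.closedBall w (t - s) ⊆ Metric.closedBall 0 t := by
    apply Metric.closedBall_subset_closedBall'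
    rw [dist_zero_right]
    linarith
  have hd : DifferentiableOn ℂ f (Metric.closedBall w (t - s)) :=
    hf.mono (hsub.trans (Metric.closedBall_subset_ball ht))
  refine Complex.norm_deriv_le_of_forall_mem_sphere_norm_le (sub_pos.2 hst) ?_ fun z hz => ?_
  · exact DifferentiableOn.diffContOnCl (hd.mono Metric.closure_ball_subset_closedBall)
  · exact hA z (by simpa using hsub (Metric.sphere_subset_closedBall hz))

lemma norm_deriv_deriv_le_of_blochNorm_le_one (hf : MemBloch 1 f) (hn : blochNorm 1 f ≤ 1)
    (hw : w ∈ unitDisk) : ‖deriv (deriv f) w‖ ≤ 16 / (1 - ‖w‖ ^ 2) ^ 2 := by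
  have hw1 := mem_unitDisk.1 hw
  have hw0 := norm_nonneg w
  have hp := one_sub_sq_pos hw
  have hq : 0 < 1 - ‖w‖ := by linarith
  have h := norm_deriv_le_of_forall_closedBall (s := ‖w‖) (t := (1 + ‖w‖) / 2)
    (A := 2 / (1 - ‖w‖)) (differentiableOn_deriv hf.1) (by linarith) (by linarith)
    (fun z hz => ?_) le_rfl
  · refine h.trans ?_
    rw [div_div, div_le_div_iff₀ (by nlinarith) (by positivity)]
    have : 1 - ‖w‖ ^ 2 ≤ 2 * (1 - ‖w‖) := by nlinarith
    nlinarith [pow_le_pow_left₀ hp.le this 2]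
  · have hz1 : ‖z‖ < 1 := by linarith
    refine (hf.norm_deriv_le hn (mem_unitDisk.2 hz1)).trans ?_
    rw [div_le_div_iff₀ (one_sub_sq_pos (mem_unitDisk.2 hz1)) hq]
    nlinarith [norm_nonneg z]

lemma dist_le_of_blochNorm_le_one {ρ : ℝ} (hf : MemBloch 1 f) (hn : blochNorm 1 f ≤ 1)
    (hρ : ρ < 1) {x y : ℂ} (hx : ‖x‖ ≤ ρ) (hy : ‖y‖ ≤ ρ) :
    ‖f y - f x‖ ≤ 1 / (1 - ρ ^ 2) * ‖y - x‖ := by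
  have hρ0 : 0 ≤ ρ := (norm_nonneg x).trans hx
  have hmem : ∀ z ∈ Metric.closedBall (0 : ℂ) ρ, z ∈ unitDisk := fun z hz =>
    mem_unitDisk.2 ((mem_closedBall_zero_iff.1 hz).trans_lt hρ)
  refine (convex_closedBall (0 : ℂ) ρ).norm_image_sub_le_of_norm_deriv_le
    (fun z hz => differentiableAt_of_mem hf.1 (hmem z hz)) (fun z hz => ?_)
    (mem_closedBall_zero_iff.2 hx) (mem_closedBall_zero_iff.2 hy)
  refine (hf.norm_deriv_le hn (hmem z hz)).trans ?_
  have := mem_closedBall_zero_iff.1 hz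
  apply one_div_le_one_div_of_le <;> nlinarith [norm_nonneg z]

end Growth

section Dilation

variable {f : ℂ → ℂ} {r : ℝ} {z : ℂ}

/-- The dilation `f_r(z) = f(rz)`. -/
def dilate (r : ℝ) (f : ℂ → ℂ) : ℂ → ℂ := fun z => f (r * z)

lemma norm_dilate_arg (hr : 0 ≤ r) : ‖(r : ℂ) * z‖ = r * ‖z‖ := by
  rw [norm_mul, norm_real, Real.norm_of_nonneg hr]

lemma mul_mem_unitDisk (hr : 0 ≤ r) (hr1 : r ≤ 1) (hz : z ∈ unitDisk) :
    (r : ℂ) * z ∈ unitDisk := by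
  have := mem_unitDisk.1 hz
  rw [mem_unitDisk, norm_dilate_arg hr]
  nlinarith [norm_nonneg z]

lemma deriv_dilate (r : ℝ) (f : ℂ → ℂ) (z : ℂ) :
    deriv (dilate r f) z = r * deriv f (r * z) := by
  exact (deriv_comp_mul_left (r : ℂ) f z).trans (smul_eq_mul _ _)

lemma differentiableOn_dilate (hf : DifferentiableOn ℂ f unitDisk) (hr : 0 ≤ r) (hr1 : r ≤ 1) :
    DifferentiableOn ℂ (dilate r f) unitDisk :=
  hf.comp (by fun_prop) fun _ hz => mul_mem_unitDisk hr hr1 hz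

lemma weight_mul_deriv_dilate_le (hf : MemBloch 1 f) (hr : 0 ≤ r) (hr1 : r ≤ 1)
    (hz : z ∈ unitDisk) : (1 - ‖z‖ ^ 2) * ‖deriv (dilate r f) z‖ ≤ wnorm 1 (deriv f) := by
  have h := le_wnorm hf.2 (mul_mem_unitDisk hr hr1 hz)
  rw [Real.rpow_one, norm_dilate_arg hr] at h
  rw [deriv_dilate, norm_mul, norm_real, Real.norm_of_nonneg hr]
  refine le_trans ?_ h
  have h1 := one_sub_sq_pos hz
  have h2 : 1 - ‖z‖ ^ 2 ≤ 1 - (r * ‖z‖) ^ 2 := by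
    nlinarith [mul_nonneg hr (norm_nonneg z), norm_nonneg z, mul_le_mul_of_nonneg_right hr1 (norm_nonneg z)]
  have h4 := h1.le.trans h2
  have h3 : r * ‖deriv f (r * z)‖ ≤ ‖deriv f (r * z)‖ := mul_le_of_le_one_left (norm_nonneg _) hr1
  gcongr

lemma MemBloch.dilate (hf : MemBloch 1 f) (hr : 0 ≤ r) (hr1 : r ≤ 1) :
    MemBloch 1 (dilate r f) :=
  memBloch_of_le (differentiableOn_dilate hf.1 hr hr1) fun _ hz =>
    weight_mul_deriv_dilate_le hf hr hr1 hz

lemma blochNorm_dilate_le (hf : MemBloch 1 f) (hr : 0 ≤ r) (hr1 : r ≤ 1) :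
    blochNorm 1 (dilate r f) ≤ blochNorm 1 f :=
  blochNorm_le (by simp [_root_.dilate]) fun _ hz => weight_mul_deriv_dilate_le hf hr hr1 hz

/-- Dilations converge to the identity, with two derivatives, uniformly on the Bloch unit ball
and on compact subsets of the disk. -/
lemma exists_dilate_close {s ε : ℝ} (hs0 : 0 ≤ s) (hs : s < 1) (hε : 0 < ε) :
    ∃ r : ℝ, 0 < r ∧ r < 1 ∧ ∀ f, MemBloch 1 f → blochNorm 1 f ≤ 1 → ∀ w, ‖w‖ ≤ s →
      ‖f w - dilate r f w‖ ≤ ε ∧ ‖deriv (fun z => f z - dilate r f z) w‖ ≤ ε ∧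
      ‖deriv (deriv (fun z => f z - dilate r f z)) w‖ ≤ ε := by
  obtain ⟨d, hd⟩ : ∃ d, d = (1 - s) / 3 := ⟨_, rfl⟩
  have hd0 : 0 < d := by rw [hd]; linarith
  have hd1 : d < 1 := by rw [hd]; linarith
  have hρ : s + 2 * d < 1 := by linarith
  have hq : 0 < 1 - (s + 2 * d) ^ 2 := by nlinarith
  obtain ⟨δ, hδ⟩ : ∃ δ, δ = min (1 / 2) (ε * d ^ 2 * (1 - (s + 2 * d) ^ 2)) := ⟨_, rfl⟩
  have hδ0 : 0 < δ := by rw [hδ]; positivity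
  have hδ1 : δ ≤ 1 / 2 := hδ ▸ min_le_left _ _
  have hδ2 : δ ≤ ε * d ^ 2 * (1 - (s + 2 * d) ^ 2) := hδ ▸ min_le_right _ _
  refine ⟨1 - δ, by linarith, by linarith, fun f hf hn w hw => ?_⟩
  have hr0 : 0 ≤ 1 - δ := by linarith
  have hr1 : 1 - δ ≤ 1 := by linarith
  have hdiff : DifferentiableOn ℂ (fun z => f z - dilate (1 - δ) f z) unitDisk :=
    hf.1.sub (differentiableOn_dilate hf.1 hr0 hr1)
  have h0 : ∀ z, ‖z‖ ≤ s + 2 * d → ‖f z - dilate (1 - δ) f z‖ ≤ ε * d ^ 2 := by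
    intro z hz
    have hrz : ‖((1 - δ : ℝ) : ℂ) * z‖ ≤ s + 2 * d := by
      rw [norm_dilate_arg hr0]
      exact (mul_le_of_le_one_left (norm_nonneg _) hr1).trans hz
    refine (dist_le_of_blochNorm_le_one hf hn hρ hrz hz).trans ?_
    have h1 : ‖z - ((1 - δ : ℝ) : ℂ) * z‖ = δ * ‖z‖ := by
      rw [← norm_dilate_arg hδ0.le]
      congr 1
      push_cast
      ring
    rw [h1, one_div_mul_eq_div, div_le_iff₀ hq]
    nlinarith [norm_nonneg z]
  have h1 : ∀ z, ‖z‖ ≤ s + d → ‖deriv (fun z => f z - dilate (1 - δ) f z) z‖ ≤ ε * d := by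
    intro z hz
    have h := norm_deriv_le_of_forall_closedBall hdiff (by linarith) hρ h0 hz
    refine h.trans (le_of_eq ?_)
    rw [show s + 2 * d - (s + d) = d by ring]
    field_simp
  have h2 := norm_deriv_le_of_forall_closedBall (differentiableOn_deriv hdiff)
    (by linarith) (by linarith) h1 hw
  rw [add_sub_cancel_left, mul_div_cancel_right₀ _ hd0.ne'] at h2
  refine ⟨(h0 w (by linarith)).trans ?_, (h1 w (by linarith)).trans ?_, h2⟩
  · exact mul_le_of_le_one_right hε.le (pow_le_one₀ hd0.le hd1.le)
  · exact mul_le_of_le_one_right hε.le hd1.le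

/-- The restriction of the Bloch unit ball to a smaller disk is totally bounded. -/
lemma exists_finite_net {ρ η : ℝ} (hρ : ρ < 1) (hη : 0 < η) :
    ∃ T : Finset (ℂ → ℂ), (∀ g ∈ T, MemBloch 1 g ∧ blochNorm 1 g ≤ 1) ∧
      ∀ f, MemBloch 1 f → blochNorm 1 f ≤ 1 →
        ∃ g ∈ T, ∀ z, ‖z‖ ≤ ρ → ‖f z - g z‖ ≤ η := by
  classical
  let X := Metric.closedBall (0 : ℂ) ρ
  have hX : ∀ x : X, ‖(x : ℂ)‖ ≤ ρ := fun x => mem_closedBall_zero_iff.1 x.2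
  let 𝒜 : Set (BoundedContinuousFunction X ℂ) :=
    {F | ∃ f, MemBloch 1 f ∧ blochNorm 1 f ≤ 1 ∧ ∀ x : X, F x = f x}
  have hcomp : IsCompact (closure 𝒜) := by
    refine BoundedContinuousFunction.arzela_ascoli
      (Metric.closedBall 0 (1 - Real.log (1 - ρ))) (isCompact_closedBall _ _) 𝒜 ?_ ?_
    · rintro F x ⟨f, hf, hn, hF⟩
      have hx := hX x
      rw [mem_closedBall_zero_iff, hF]
      refine (norm_le_of_blochNorm_le_one hf hn (mem_unitDisk.2 (hx.trans_lt hρ))).trans ?_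
      have := Real.log_le_log (by linarith : 0 < 1 - ρ) (by linarith : 1 - ρ ≤ 1 - ‖(x : ℂ)‖)
      linarith
    · refine Metric.equicontinuous_of_continuity_modulus (fun t => 1 / (1 - ρ ^ 2) * t) ?_ _ ?_
      · have h := (tendsto_id (α := ℝ) (x := 𝓝 0)).const_mul (1 / (1 - ρ ^ 2))
        rwa [mul_zero] at h
      · rintro x y ⟨F, f, hf, hn, hF⟩
        change dist (F x) (F y) ≤ 1 / (1 - ρ ^ 2) * dist (x : ℂ) y
        rw [hF, hF, dist_eq_norm, dist_eq_norm]
        exact dist_le_of_blochNorm_le_one hf hn hρ (hX y) (hX x)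
  obtain ⟨t, ht, hfin, hcov⟩ := Metric.finite_approx_of_totallyBounded
    (hcomp.totallyBounded.subset subset_closure) η hη
  choose! rep hrep using (fun F (hF : F ∈ 𝒜) => hF)
  refine ⟨hfin.toFinset.image rep, ?_, fun f hf hn => ?_⟩
  · intro g hg
    obtain ⟨F, hF, rfl⟩ := Finset.mem_image.1 hg
    have := hrep F (ht (hfin.mem_toFinset.1 hF))
    exact ⟨this.1, this.2.1⟩
  · have hc : Continuous (fun x : X => f x) :=
      (hf.1.continuousOn.mono fun z hz =>
        mem_unitDisk.2 ((mem_closedBall_zero_iff.1 hz).trans_lt hρ)).domRestrict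
    let F : BoundedContinuousFunction X ℂ := BoundedContinuousFunction.mkOfCompact ⟨_, hc⟩
    have hFA : F ∈ 𝒜 := ⟨f, hf, hn, fun _ => rfl⟩
    obtain ⟨G, hG, hFG⟩ := mem_iUnion₂.1 (hcov hFA)
    refine ⟨rep G, Finset.mem_image_of_mem _ (hfin.mem_toFinset.2 hG), fun z hz => ?_⟩
    have h1 := (BoundedContinuousFunction.dist_coe_le_dist
      (f := F) (g := G) ⟨z, mem_closedBall_zero_iff.2 hz⟩).trans (Metric.mem_ball.1 hFG).le
    rw [(hrep G (ht hG)).2.2, dist_eq_norm] at h1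
    exact h1

end Dilation

section Symbols

/-- The symbol multiplying `f ∘ φ` in `(uC_φ f)''`, with its Bloch weight. -/
def zerothSymbol (β : ℝ) (u φ : ℂ → ℂ) (z : ℂ) : ℝ :=
  (1 - ‖z‖ ^ 2) ^ β * ‖deriv (deriv u) z‖ * Real.log (Real.exp 1 / (1 - ‖φ z‖ ^ 2))

/-- The symbol multiplying `f' ∘ φ` in `(uC_φ f)''`, with its Bloch weight. -/
def firstSymbol (β : ℝ) (u φ : ℂ → ℂ) (z : ℂ) : ℝ :=
  (1 - ‖z‖ ^ 2) ^ β * ‖2 * deriv u z * deriv φ z + u z * deriv (deriv φ) z‖ / (1 - ‖φ z‖ ^ 2)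

/-- The symbol multiplying `f'' ∘ φ` in `(uC_φ f)''`, with its Bloch weight. -/
def secondSymbol (β : ℝ) (u φ : ℂ → ℂ) (z : ℂ) : ℝ :=
  (1 - ‖z‖ ^ 2) ^ β * (‖u z‖ * ‖deriv φ z‖ ^ 2) / (1 - ‖φ z‖ ^ 2) ^ 2

variable {β : ℝ} {f u φ : ℂ → ℂ} {z : ℂ}

lemma one_le_log_exp_div {w : ℂ} (hw : w ∈ unitDisk) :
    1 ≤ Real.log (Real.exp 1 / (1 - ‖w‖ ^ 2)) := by
  have h := one_sub_sq_pos hw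
  rw [Real.log_div (Real.exp_pos 1).ne' h.ne', Real.log_exp]
  linarith [Real.log_nonpos h.le (one_sub_sq_le_one w)]

lemma zerothSymbol_nonneg (hm : MapsTo φ unitDisk unitDisk) (hz : z ∈ unitDisk) :
    0 ≤ zerothSymbol β u φ z :=
  mul_nonneg (mul_nonneg (weight_nonneg β hz) (norm_nonneg _))
    (zero_le_one.trans (one_le_log_exp_div (hm hz)))

lemma firstSymbol_nonneg (hm : MapsTo φ unitDisk unitDisk) (hz : z ∈ unitDisk) :
    0 ≤ firstSymbol β u φ z :=
  div_nonneg (mul_nonneg (weight_nonneg β hz) (norm_nonneg _)) (one_sub_sq_pos (hm hz)).le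

lemma secondSymbol_nonneg (hz : z ∈ unitDisk) : 0 ≤ secondSymbol β u φ z :=
  div_nonneg (mul_nonneg (weight_nonneg β hz) (by positivity)) (sq_nonneg _)

lemma weight_mul_deriv_deriv_wcomp_le_symbols {a b c : ℝ} (hu : DifferentiableOn ℂ u unitDisk)
    (hφ : DifferentiableOn ℂ φ unitDisk) (hm : MapsTo φ unitDisk unitDisk)
    (hf : DifferentiableOn ℂ f unitDisk) (hz : z ∈ unitDisk)
    (ha : ‖f (φ z)‖ ≤ a * Real.log (Real.exp 1 / (1 - ‖φ z‖ ^ 2)))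
    (hb : ‖deriv f (φ z)‖ ≤ b / (1 - ‖φ z‖ ^ 2))
    (hc : ‖deriv (deriv f) (φ z)‖ ≤ c / (1 - ‖φ z‖ ^ 2) ^ 2) :
    (1 - ‖z‖ ^ 2) ^ β * ‖deriv (deriv (wcomp u φ f)) z‖ ≤
      a * zerothSymbol β u φ z + b * firstSymbol β u φ z + c * secondSymbol β u φ z := by
  have hw := weight_nonneg β hz
  refine (weight_mul_deriv_deriv_wcomp_le hu hφ hm hf hz).trans
    (add_le_add (add_le_add ?_ ?_) ?_)
  · refine (mul_le_mul_of_nonneg_left ha (by positivity)).trans_eq ?_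
    unfold zerothSymbol
    ring
  · refine (mul_le_mul_of_nonneg_left hb (by positivity)).trans_eq ?_
    unfold firstSymbol
    ring
  · refine (mul_le_mul_of_nonneg_left hc (by positivity)).trans_eq ?_
    unfold secondSymbol
    ring

/-- The three symbols at `z` are recovered from the action of `uC_φ` on the test functions
centred at `φ z`. -/
lemma symbols_le {X : ℝ} (hu : DifferentiableOn ℂ u unitDisk)
    (hφ : DifferentiableOn ℂ φ unitDisk) (hm : MapsTo φ unitDisk unitDisk) (hz : z ∈ unitDisk)
    (h₀ : (1 - ‖z‖ ^ 2) ^ β * ‖deriv (deriv (wcomp u φ (logTest (φ z)))) z‖ ≤ X)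
    (h₁ : (1 - ‖z‖ ^ 2) ^ β * ‖deriv (deriv (wcomp u φ (diskMoebius (φ z)))) z‖ ≤ X)
    (h₂ : (1 - ‖z‖ ^ 2) ^ β *
      ‖deriv (deriv (wcomp u φ (fun x => diskMoebius (φ z) x ^ 2))) z‖ ≤ X) :
    zerothSymbol β u φ z ≤ 5 * X ∧ firstSymbol β u φ z ≤ 3 * X ∧ secondSymbol β u φ z ≤ X := by
  have hw := hm hz
  have hp := one_sub_sq_pos hw
  have hW := weight_nonneg β hz
  have hsub := unitDisk_subset_testDomain hw
  rw [deriv_deriv_wcomp hu hφ hm ((differentiableOn_logTest _).mono hsub) hz] at h₀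
  rw [deriv_deriv_wcomp hu hφ hm ((differentiableOn_diskMoebius _).mono hsub) hz] at h₁
  rw [deriv_deriv_wcomp hu hφ hm ((differentiableOn_diskMoebius_sq _).mono hsub) hz] at h₂
  have e₂ : secondSymbol β u φ z * 2 ≤ X := by
    rw [deriv_diskMoebius_sq_self hw, diskMoebius_self] at h₂
    simp only [ne_eq, OfNat.ofNat_ne_zero, not_false_eq_true, zero_pow, mul_zero, zero_add,
      norm_mul, norm_pow] at h₂
    rw [deriv_deriv_diskMoebius_sq_self hw] at h₂
    refine le_of_eq_of_le ?_ h₂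
    unfold secondSymbol
    ring
  have n₂ : 0 ≤ secondSymbol β u φ z := secondSymbol_nonneg hz
  have t₂ : ∀ {a : ℂ} {k : ℝ}, ‖a‖ ≤ k / (1 - ‖φ z‖ ^ 2) ^ 2 →
      (1 - ‖z‖ ^ 2) ^ β * ‖u z * deriv φ z ^ 2 * a‖ ≤ k * secondSymbol β u φ z := by
    intro a k ha
    rw [norm_mul, norm_mul, norm_pow]
    calc _ ≤ (1 - ‖z‖ ^ 2) ^ β * (‖u z‖ * ‖deriv φ z‖ ^ 2 * (k / (1 - ‖φ z‖ ^ 2) ^ 2)) := by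
          gcongr
      _ = _ := by
        unfold secondSymbol
        ring
  have e₁ : firstSymbol β u φ z ≤ X + 2 * secondSymbol β u φ z := by
    rw [diskMoebius_self, mul_zero, zero_add] at h₁
    have h := mul_le_mul_of_nonneg_left (norm_le_add_norm_add
      ((2 * deriv u z * deriv φ z + u z * deriv (deriv φ) z) * deriv (diskMoebius (φ z)) (φ z))
      (u z * deriv φ z ^ 2 * deriv (deriv (diskMoebius (φ z))) (φ z))) hW
    have h' := t₂ (deriv_deriv_diskMoebius_self_le hw)
    rw [norm_mul, deriv_diskMoebius_self hw] at h
    have : firstSymbol β u φ z = (1 - ‖z‖ ^ 2) ^ β *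
        (‖2 * deriv u z * deriv φ z + u z * deriv (deriv φ) z‖ * (1 / (1 - ‖φ z‖ ^ 2))) := by
      unfold firstSymbol
      ring
    linarith
  have e₀ : zerothSymbol β u φ z ≤ X + firstSymbol β u φ z + secondSymbol β u φ z := by
    rw [add_assoc] at h₀
    have h := mul_le_mul_of_nonneg_left (norm_le_add_norm_add
      (deriv (deriv u) z * logTest (φ z) (φ z))
      ((2 * deriv u z * deriv φ z + u z * deriv (deriv φ) z) * deriv (logTest (φ z)) (φ z) +
        u z * deriv φ z ^ 2 * deriv (deriv (logTest (φ z))) (φ z))) hW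
    have h' := t₂ (norm_deriv_deriv_logTest_self_le hw)
    have h'' := mul_le_mul_of_nonneg_left (norm_add_le
      ((2 * deriv u z * deriv φ z + u z * deriv (deriv φ) z) * deriv (logTest (φ z)) (φ z))
      (u z * deriv φ z ^ 2 * deriv (deriv (logTest (φ z))) (φ z))) hW
    have h''' : (1 - ‖z‖ ^ 2) ^ β * ‖(2 * deriv u z * deriv φ z + u z * deriv (deriv φ) z) *
        deriv (logTest (φ z)) (φ z)‖ ≤ firstSymbol β u φ z := by
      rw [norm_mul]
      calc _ ≤ (1 - ‖z‖ ^ 2) ^ β * (‖2 * deriv u z * deriv φ z + u z * deriv (deriv φ) z‖ *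
            (1 / (1 - ‖φ z‖ ^ 2))) := by
            gcongr
            exact norm_deriv_logTest_self_le hw
        _ = _ := by
          unfold firstSymbol
          ring
    rw [norm_mul, norm_logTest_self hw] at h
    have : zerothSymbol β u φ z = (1 - ‖z‖ ^ 2) ^ β *
        (‖deriv (deriv u) z‖ * Real.log (Real.exp 1 / (1 - ‖φ z‖ ^ 2))) := by
      unfold zerothSymbol
      ring
    linarith
  refine ⟨?_, ?_, ?_⟩ <;> linarith

lemma exists_symbols_bound (hu : DifferentiableOn ℂ u unitDisk)
    (hφ : DifferentiableOn ℂ φ unitDisk) (hm : MapsTo φ unitDisk unitDisk)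
    (hT : BoundedBlochToZygmund 1 β u φ) :
    ∃ A, 0 < A ∧ ∀ z ∈ unitDisk, zerothSymbol β u φ z ≤ A ∧ firstSymbol β u φ z ≤ A ∧
      secondSymbol β u φ z ≤ A := by
  obtain ⟨hmem, C, hC, hbd⟩ := hT
  have key : ∀ f, MemBloch 1 f → blochNorm 1 f ≤ 3 → ∀ z ∈ unitDisk,
      (1 - ‖z‖ ^ 2) ^ β * ‖deriv (deriv (wcomp u φ f)) z‖ ≤ C * 3 := fun f hf hn z hz =>
    ((hmem f hf).weight_mul_le hz).trans ((hbd f hf).trans (by gcongr))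
  refine ⟨5 * (C * 3), by positivity, fun z hz => ?_⟩
  have hw := hm hz
  obtain ⟨h₀, h₁, h₂⟩ := symbols_le hu hφ hm hz
    (key _ (memBloch_of_testDomain hw (differentiableOn_logTest _) fun _ =>
      weight_mul_deriv_logTest_le hw) (blochNorm_logTest_le hw) z hz)
    (key _ (memBloch_of_testDomain hw (differentiableOn_diskMoebius _) fun _ =>
      weight_mul_deriv_diskMoebius_le' hw) (blochNorm_diskMoebius_le hw) z hz)
    (key _ (memBloch_of_testDomain hw (differentiableOn_diskMoebius_sq _) fun _ =>
      weight_mul_deriv_diskMoebius_sq_le hw) (blochNorm_diskMoebius_sq_le hw) z hz)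
  refine ⟨?_, ?_, ?_⟩ <;> linarith

end Symbols

section BoundaryFilter

/-- The filter on the disk expressing `|φ(z)| → 1`. -/
def towardBoundary (φ : ℂ → ℂ) : Filter ℂ :=
  comap (fun z => ‖φ z‖) (𝓝[<] 1) ⊓ 𝓟 unitDisk

variable {φ : ℂ → ℂ} {F : ℂ → ℝ}

lemma eventually_towardBoundary_iff (hm : MapsTo φ unitDisk unitDisk) {p : ℂ → Prop} :
    (∀ᶠ z in towardBoundary φ, p z) ↔
      ∃ s ∈ Ico (0 : ℝ) 1, ∀ z ∈ unitDisk, s < ‖φ z‖ → p z := by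
  rw [towardBoundary, eventually_inf_principal, ((nhdsLT_basis (1 : ℝ)).comap _).eventually_iff]
  constructor
  · rintro ⟨a, ha, h⟩
    exact ⟨max a 0, ⟨le_max_right _ _, max_lt ha one_pos⟩, fun z hz hs =>
      h ⟨(le_max_left _ _).trans_lt hs, mem_unitDisk.1 (hm hz)⟩ hz⟩
  · rintro ⟨s, hs, h⟩
    exact ⟨s, hs.2, fun z hz hzD => h z hzD hz.1⟩

lemma eventually_mem_unitDisk (φ : ℂ → ℂ) : ∀ᶠ z in towardBoundary φ, z ∈ unitDisk :=
  mem_inf_of_right (mem_principal_self _)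

lemma phiLimsup_nonneg (hF : ∀ z ∈ unitDisk, 0 ≤ F z) : 0 ≤ phiLimsup φ F := by
  apply Real.sInf_nonneg
  rintro _ ⟨s, -, rfl⟩
  apply Real.sSup_nonneg
  rintro _ ⟨z, hz, -, rfl⟩
  exact hF z hz

lemma phiLimsup_le (hm : MapsTo φ unitDisk unitDisk) (hF : ∀ z ∈ unitDisk, 0 ≤ F z) {X : ℝ}
    (hX : 0 ≤ X) (h : ∀ᶠ z in towardBoundary φ, F z ≤ X) : phiLimsup φ F ≤ X := by
  obtain ⟨s, hs, h⟩ := (eventually_towardBoundary_iff hm).1 h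
  have h1 : phiLimsup φ F ≤ sSup {y | ∃ z ∈ unitDisk, s < ‖φ z‖ ∧ y = F z} := by
    refine csInf_le ⟨0, ?_⟩ ⟨s, hs, rfl⟩
    rintro _ ⟨s, -, rfl⟩
    apply Real.sSup_nonneg
    rintro _ ⟨z, hz, -, rfl⟩
    exact hF z hz
  refine h1.trans (Real.sSup_le ?_ hX)
  rintro _ ⟨z, hz, hsz, rfl⟩
  exact h z hz hsz

lemma eventually_le_of_phiLimsup_lt (hm : MapsTo φ unitDisk unitDisk) {A X : ℝ}
    (hA : ∀ z ∈ unitDisk, F z ≤ A) (hX : phiLimsup φ F < X) :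
    ∀ᶠ z in towardBoundary φ, F z ≤ X := by
  obtain ⟨_, ⟨s, hs, rfl⟩, hlt⟩ := exists_lt_of_csInf_lt
    (Set.Nonempty.image _ ⟨0, left_mem_Ico.2 one_pos⟩) hX
  refine (eventually_towardBoundary_iff hm).2 ⟨s, hs, fun z hz hsz => ?_⟩
  have hb : BddAbove {y | ∃ z ∈ unitDisk, s < ‖φ z‖ ∧ y = F z} := by
    refine ⟨A, ?_⟩
    rintro _ ⟨z, hz, -, rfl⟩
    exact hA z hz
  exact (le_csSup hb ⟨z, hz, hsz, rfl⟩).trans hlt.le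

lemma tendsto_one_sub_sq (φ : ℂ → ℂ) :
    Tendsto (fun z => 1 - ‖φ z‖ ^ 2) (towardBoundary φ) (𝓝 0) := by
  have h1 : Tendsto (fun z => ‖φ z‖) (towardBoundary φ) (𝓝 1) :=
    (tendsto_comap.mono_left inf_le_left).mono_right nhdsWithin_le_nhds
  simpa using (h1.pow 2).const_sub 1

lemma tendsto_inv_log (hm : MapsTo φ unitDisk unitDisk) :
    Tendsto (fun z => (Real.log (Real.exp 1 / (1 - ‖φ z‖ ^ 2)))⁻¹) (towardBoundary φ) (𝓝 0) := by
  have h1 : Tendsto (fun z => 1 - ‖φ z‖ ^ 2) (towardBoundary φ) (𝓝[>] 0) :=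
    tendsto_nhdsWithin_iff.2 ⟨tendsto_one_sub_sq φ, by
      filter_upwards [eventually_mem_unitDisk φ] with z hz using one_sub_sq_pos (hm hz)⟩
  refine (Real.tendsto_log_atTop.comp ?_).inv_tendsto_atTop
  simpa [div_eq_mul_inv] using h1.inv_tendsto_nhdsGT_zero.const_mul_atTop (Real.exp_pos 1)

end BoundaryFilter

section EssentialNorm

variable {β : ℝ} {f g u φ : ℂ → ℂ} {z : ℂ}

lemma wcomp_sub (u φ f g : ℂ → ℂ) :
    (fun z => wcomp u φ f z - wcomp u φ g z) = wcomp u φ (fun z => f z - g z) :=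
  funext fun _ => (mul_sub _ _ _).symm

lemma wcomp_const_mul (u φ f : ℂ → ℂ) (c : ℂ) :
    wcomp u φ (fun z => c * f z) = fun z => c * wcomp u φ f z :=
  funext fun _ => mul_left_comm _ _ _

lemma deriv_deriv_const_mul (c : ℂ) (f : ℂ → ℂ) (z : ℂ) :
    deriv (deriv (fun z => c * f z)) z = c * deriv (deriv f) z := by
  rw [show deriv (fun z => c * f z) = fun z => c * deriv f z from
    funext fun _ => deriv_const_mul_field c, deriv_const_mul_field]

lemma isCompactOpToZygmund_dilate (hT : BoundedBlochToZygmund 1 β u φ) {r : ℝ} (hr : 0 ≤ r)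
    (hr1 : r < 1) :
    IsCompactOpToZygmund 1 β (MemBloch 1) (fun f => wcomp u φ (dilate r f)) := by
  classical
  obtain ⟨hmem, C, hC, hbd⟩ := hT
  refine ⟨fun f g _ _ a b => ?_, fun f hf => hmem _ (hf.dilate hr hr1.le),
    ⟨C, fun f hf => (hbd _ (hf.dilate hr hr1.le)).trans
      (mul_le_mul_of_nonneg_left (blochNorm_dilate_le hf hr hr1.le) hC.le)⟩, fun ε hε => ?_⟩
  · funext z
    simp only [wcomp, dilate]
    ring
  · obtain ⟨ρ, hrρ, hρ⟩ := exists_between hr1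
    have hd : 0 < ρ - r := sub_pos.2 hrρ
    obtain ⟨η, hη, hηε⟩ : ∃ η, 0 < η ∧ C * (η + η / (ρ - r)) = ε := by
      refine ⟨ε / (C * (1 + 1 / (ρ - r))), by positivity, ?_⟩
      field_simp
    obtain ⟨T, hT, hnet⟩ := exists_finite_net hρ hη
    refine ⟨T.image fun g => wcomp u φ (dilate r g), ?_, fun f hf hn => ?_⟩
    · intro G hG
      obtain ⟨g, hg, rfl⟩ := Finset.mem_image.1 hG
      exact hmem _ ((hT g hg).1.dilate hr hr1.le)
    · obtain ⟨g, hg, hfg⟩ := hnet f hf hn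
      refine ⟨_, Finset.mem_image_of_mem _ hg, ?_⟩
      have hs := hf.sub (hT g hg).1
      rw [wcomp_sub]
      refine (hbd _ (hs.dilate hr hr1.le)).trans ?_
      rw [← hηε]
      gcongr
      refine blochNorm_le ?_ fun z hz => ?_
      · have h := hfg 0 (by simpa using hr.trans hrρ.le)
        simpa [dilate] using h
      · have hz1 := (mem_unitDisk.1 hz).le
        have h := norm_deriv_le_of_forall_closedBall hs.1 hrρ hρ hfg (w := r * z) (by
          rw [norm_dilate_arg hr]
          exact mul_le_of_le_one_right hr hz1)
        change (1 - ‖z‖ ^ 2) * ‖deriv (dilate r fun z => f z - g z) z‖ ≤ _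
        rw [deriv_dilate, norm_mul, norm_real, Real.norm_of_nonneg hr, ← mul_assoc]
        refine le_trans (mul_le_of_le_one_left (norm_nonneg _) ?_) h
        exact mul_le_one₀ (one_sub_sq_le_one z) hr hr1.le

lemma bddAbove_zygNorm_sub {K : (ℂ → ℂ) → ℂ → ℂ} (hT : BoundedBlochToZygmund 1 β u φ)
    (hK : IsCompactOpToZygmund 1 β (MemBloch 1) K) :
    BddAbove {s | ∃ f, MemBloch 1 f ∧ blochNorm 1 f ≤ 1 ∧
      s = zygNorm β (fun z => wcomp u φ f z - K f z)} := by
  obtain ⟨hmem, C, hC, hbd⟩ := hT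
  obtain ⟨-, hKmem, ⟨D, hD⟩, -⟩ := hK
  refine ⟨C + |D|, ?_⟩
  rintro _ ⟨f, hf, hn, rfl⟩
  refine (zygNorm_sub_le (hmem f hf) (hKmem f hf)).trans (add_le_add ?_ ?_)
  · exact (hbd f hf).trans (mul_le_of_le_one_right hC.le hn)
  · refine (hD f hf).trans ?_
    have h0 := blochNorm_nonneg 1 f
    calc D * blochNorm 1 f ≤ |D| * blochNorm 1 f := by gcongr; exact le_abs_self D
      _ ≤ |D| := mul_le_of_le_one_right (abs_nonneg D) hn

/-- A fixed function with bounded two-jet on the disk is negligible as `|φ(z)| → 1`. -/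
lemma eventually_weight_mul_deriv_deriv_le {A B ε : ℝ} (hu : DifferentiableOn ℂ u unitDisk)
    (hφ : DifferentiableOn ℂ φ unitDisk) (hm : MapsTo φ unitDisk unitDisk)
    (hA : ∀ z ∈ unitDisk, zerothSymbol β u φ z ≤ A ∧ firstSymbol β u φ z ≤ A ∧
      secondSymbol β u φ z ≤ A) (hf : DifferentiableOn ℂ f unitDisk)
    (hB : ∀ z ∈ unitDisk, ‖f z‖ ≤ B ∧ ‖deriv f z‖ ≤ B ∧ ‖deriv (deriv f) z‖ ≤ B) (hε : 0 < ε) :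
    ∀ᶠ z in towardBoundary φ, (1 - ‖z‖ ^ 2) ^ β * ‖deriv (deriv (wcomp u φ f)) z‖ ≤ ε := by
  have hB0 : 0 ≤ B := (norm_nonneg _).trans (hB 0 zero_mem_unitDisk).1
  have h1 := tendsto_one_sub_sq φ
  have hlim : Tendsto (fun z => B * (Real.log (Real.exp 1 / (1 - ‖φ z‖ ^ 2)))⁻¹ * A +
      B * (1 - ‖φ z‖ ^ 2) * A + B * (1 - ‖φ z‖ ^ 2) ^ 2 * A) (towardBoundary φ) (𝓝 0) := by
    simpa using ((((tendsto_inv_log hm).const_mul B).mul_const A).add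
      ((h1.const_mul B).mul_const A)).add (((h1.pow 2).const_mul B).mul_const A)
  filter_upwards [eventually_mem_unitDisk φ, hlim.eventually_le_const hε] with z hz hzε
  have hp := one_sub_sq_pos (hm hz)
  have hl := one_le_log_exp_div (hm hz)
  have hl0 : 0 < Real.log (Real.exp 1 / (1 - ‖φ z‖ ^ 2)) := by linarith
  obtain ⟨b₀, b₁, b₂⟩ := hB _ (hm hz)
  obtain ⟨a₀, a₁, a₂⟩ := hA z hz
  refine (weight_mul_deriv_deriv_wcomp_le_symbols
    (a := B * (Real.log (Real.exp 1 / (1 - ‖φ z‖ ^ 2)))⁻¹) (b := B * (1 - ‖φ z‖ ^ 2))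
    (c := B * (1 - ‖φ z‖ ^ 2) ^ 2) hu hφ hm hf hz ?_ ?_ ?_).trans (le_trans ?_ hzε)
  · rwa [mul_assoc, inv_mul_cancel₀ hl0.ne', mul_one]
  · rwa [mul_div_cancel_right₀ _ hp.ne']
  · rwa [mul_div_cancel_right₀ _ (pow_pos hp 2).ne']
  · gcongr

/-- If `K` is compact and `‖uC_φ - K‖ ≤ r`, then `uC_φ` is essentially bounded by `2 * r` on any
family of smooth functions in the Bloch unit ball indexed by the disk. -/
lemma eventually_weight_mul_deriv_deriv_family_le {r δ : ℝ} {K : (ℂ → ℂ) → ℂ → ℂ}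
    (hu : DifferentiableOn ℂ u unitDisk) (hφ : DifferentiableOn ℂ φ unitDisk)
    (hm : MapsTo φ unitDisk unitDisk) (hT : BoundedBlochToZygmund 1 β u φ)
    (hK : IsCompactOpToZygmund 1 β (MemBloch 1) K)
    (hr : ∀ f, MemBloch 1 f → blochNorm 1 f ≤ 1 →
      zygNorm β (fun z => wcomp u φ f z - K f z) ≤ r)
    {e : ℂ → ℂ → ℂ} (he : ∀ w ∈ unitDisk, MemBloch 1 (e w))
    (hen : ∀ w ∈ unitDisk, blochNorm 1 (e w) ≤ 1)
    (hej : ∀ w ∈ unitDisk, ∃ B, ∀ z ∈ unitDisk,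
      ‖e w z‖ ≤ B ∧ ‖deriv (e w) z‖ ≤ B ∧ ‖deriv (deriv (e w)) z‖ ≤ B) (hδ : 0 < δ) :
    ∀ᶠ z in towardBoundary φ,
      (1 - ‖z‖ ^ 2) ^ β * ‖deriv (deriv (wcomp u φ (e (φ z)))) z‖ ≤ 2 * r + δ := by
  obtain ⟨A, -, hA⟩ := exists_symbols_bound hu hφ hm hT
  obtain ⟨hmem, -⟩ := hT
  obtain ⟨-, hKmem, -, hKc⟩ := hK
  obtain ⟨T, hTmem, hnet⟩ := hKc (δ / 4) (by positivity)
  have main : ∀ g ∈ T, ∀ᶠ z in towardBoundary φ, z ∈ unitDisk → ∀ w ∈ unitDisk,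
      zygNorm β (fun z => K (e w) z - g z) ≤ δ / 4 →
      (1 - ‖z‖ ^ 2) ^ β * ‖deriv (deriv (wcomp u φ (e w))) z‖ ≤ 2 * r + δ := by
    intro g hg
    by_cases hex : ∃ w₀ ∈ unitDisk, zygNorm β (fun z => K (e w₀) z - g z) ≤ δ / 4
    · obtain ⟨w₀, hw₀, hgw₀⟩ := hex
      obtain ⟨B, hB⟩ := hej w₀ hw₀
      filter_upwards [eventually_weight_mul_deriv_deriv_le hu hφ hm hA (he w₀ hw₀).1 hB
        (by positivity : 0 < δ / 4)] with z hsmall hz w hw hgw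
      have hsub : ∀ {a b : ℂ → ℂ} {x : ℝ}, MemZygmund β a → MemZygmund β b →
          zygNorm β (fun z => a z - b z) ≤ x →
          (1 - ‖z‖ ^ 2) ^ β * ‖deriv (deriv a) z - deriv (deriv b) z‖ ≤ x := by
        intro a b x ha hb hx
        rw [← deriv_deriv_sub_of_mem ha.1 hb.1 hz]
        exact ((ha.sub hb).weight_mul_le hz).trans hx
      have m := hmem _ (he w hw)
      have m₀ := hmem _ (he w₀ hw₀)
      have k := hKmem _ (he w hw)
      have k₀ := hKmem _ (he w₀ hw₀)
      have h₁ := hsub m k (hr _ (he w hw) (hen w hw))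
      have h₂ := hsub m₀ k₀ (hr _ (he w₀ hw₀) (hen w₀ hw₀))
      have h₃ := hsub k (hTmem g hg) hgw
      have h₄ := hsub k₀ (hTmem g hg) hgw₀
      set p := deriv (deriv (wcomp u φ (e w))) z
      set p₀ := deriv (deriv (wcomp u φ (e w₀))) z
      set q := deriv (deriv (K (e w))) z
      set q₀ := deriv (deriv (K (e w₀))) z
      set s := deriv (deriv g) z
      have htri : ‖p‖ ≤ ‖p - q‖ + ‖q - s‖ + ‖q₀ - s‖ + ‖p₀ - q₀‖ + ‖p₀‖ := by
        calc ‖p‖ = ‖(p - q) + (q - s) - (q₀ - s) - (p₀ - q₀) + p₀‖ := by congr 1; ring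
          _ ≤ _ := (norm_add_le _ _).trans (by
            gcongr
            refine (norm_sub_le _ _).trans ?_
            gcongr
            refine (norm_sub_le _ _).trans ?_
            gcongr
            exact norm_add_le _ _)
      have := mul_le_mul_of_nonneg_left htri (weight_nonneg β hz)
      linarith
    · filter_upwards with z hz w hw hgw using absurd ⟨w, hw, hgw⟩ hex
  filter_upwards [eventually_mem_unitDisk φ, (Finset.eventually_all T).2 main] with z hz hall
  obtain ⟨g, hg, hgz⟩ := hnet _ (he _ (hm hz)) (hen _ (hm hz))
  exact hall g hg hz _ (hm hz) hgz

/-- Version of `eventually_weight_mul_deriv_deriv_family_le` for the test functions, whose Bloch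
norms are at most `3`. -/
lemma eventually_weight_mul_deriv_deriv_test_le {r δ : ℝ} {K : (ℂ → ℂ) → ℂ → ℂ}
    (hu : DifferentiableOn ℂ u unitDisk) (hφ : DifferentiableOn ℂ φ unitDisk)
    (hm : MapsTo φ unitDisk unitDisk) (hT : BoundedBlochToZygmund 1 β u φ)
    (hK : IsCompactOpToZygmund 1 β (MemBloch 1) K)
    (hr : ∀ f, MemBloch 1 f → blochNorm 1 f ≤ 1 →
      zygNorm β (fun z => wcomp u φ f z - K f z) ≤ r)
    {e : ℂ → ℂ → ℂ} (he : ∀ w, DifferentiableOn ℂ (e w) (testDomain w))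
    (hd : ∀ w ∈ unitDisk, ∀ z ∈ unitDisk, (1 - ‖z‖ ^ 2) * ‖deriv (e w) z‖ ≤ 2)
    (hen : ∀ w ∈ unitDisk, blochNorm 1 (e w) ≤ 3) (hδ : 0 < δ) :
    ∀ᶠ z in towardBoundary φ,
      (1 - ‖z‖ ^ 2) ^ β * ‖deriv (deriv (wcomp u φ (e (φ z)))) z‖ ≤ 6 * r + δ := by
  have hB : ∀ w ∈ unitDisk, MemBloch 1 (e w) := fun w hw =>
    memBloch_of_testDomain hw (he w) (hd w hw)
  have h := eventually_weight_mul_deriv_deriv_family_le hu hφ hm hT hK hr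
    (e := fun w z => (1 / 3 : ℂ) * e w z) (fun w hw => (hB w hw).const_mul _)
    (fun w hw => ?_)
    (fun w hw => exists_jet_bound (isOpen_testDomain w) (closedBall_subset_testDomain hw)
      ((he w).const_mul _)) (by positivity : 0 < δ / 3)
  · filter_upwards [h] with z hz
    rw [wcomp_const_mul, deriv_deriv_const_mul, norm_mul] at hz
    have : ‖(1 / 3 : ℂ)‖ = 1 / 3 := by simp
    rw [this] at hz
    linarith
  · refine (blochNorm_const_mul_le (hB w hw) _).trans ?_
    have : ‖(1 / 3 : ℂ)‖ = 1 / 3 := by simp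
    rw [this]
    linarith [hen w hw]

lemma phiLimsup_symbols_le {r : ℝ} {K : (ℂ → ℂ) → ℂ → ℂ}
    (hu : DifferentiableOn ℂ u unitDisk) (hφ : DifferentiableOn ℂ φ unitDisk)
    (hm : MapsTo φ unitDisk unitDisk) (hT : BoundedBlochToZygmund 1 β u φ)
    (hK : IsCompactOpToZygmund 1 β (MemBloch 1) K) (hr0 : 0 ≤ r)
    (hr : ∀ f, MemBloch 1 f → blochNorm 1 f ≤ 1 →
      zygNorm β (fun z => wcomp u φ f z - K f z) ≤ r) :
    max (phiLimsup φ (zerothSymbol β u φ))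
      (max (phiLimsup φ (firstSymbol β u φ)) (phiLimsup φ (secondSymbol β u φ))) ≤ 30 * r := by
  refine le_of_forall_pos_le_add fun δ hδ => ?_
  have hδ' : 0 < δ / 5 := by positivity
  have h : ∀ᶠ z in towardBoundary φ, zerothSymbol β u φ z ≤ 30 * r + δ ∧
      firstSymbol β u φ z ≤ 30 * r + δ ∧ secondSymbol β u φ z ≤ 30 * r + δ := by
    filter_upwards [eventually_mem_unitDisk φ,
      eventually_weight_mul_deriv_deriv_test_le hu hφ hm hT hK hr differentiableOn_logTest
        (fun _ hw _ => weight_mul_deriv_logTest_le hw) (fun _ => blochNorm_logTest_le) hδ',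
      eventually_weight_mul_deriv_deriv_test_le hu hφ hm hT hK hr differentiableOn_diskMoebius
        (fun _ hw _ => weight_mul_deriv_diskMoebius_le' hw) (fun _ => blochNorm_diskMoebius_le)
        hδ',
      eventually_weight_mul_deriv_deriv_test_le hu hφ hm hT hK hr
        (e := fun w z => diskMoebius w z ^ 2) differentiableOn_diskMoebius_sq
        (fun _ hw _ => weight_mul_deriv_diskMoebius_sq_le hw)
        (fun _ => blochNorm_diskMoebius_sq_le) hδ'] with z hz h₀ h₁ h₂
    obtain ⟨s₀, s₁, s₂⟩ := symbols_le hu hφ hm hz h₀ h₁ h₂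
    refine ⟨?_, ?_, ?_⟩ <;> linarith
  have hX : 0 ≤ 30 * r + δ := by positivity
  refine max_le ?_ (max_le ?_ ?_)
  · exact phiLimsup_le hm (fun _ => zerothSymbol_nonneg hm) hX (h.mono fun _ h => h.1)
  · exact phiLimsup_le hm (fun _ => firstSymbol_nonneg hm) hX (h.mono fun _ h => h.2.1)
  · exact phiLimsup_le hm (fun _ => secondSymbol_nonneg) hX (h.mono fun _ h => h.2.2)

lemma le_essNormZ (hu : DifferentiableOn ℂ u unitDisk) (hφ : DifferentiableOn ℂ φ unitDisk)
    (hm : MapsTo φ unitDisk unitDisk) (hT : BoundedBlochToZygmund 1 β u φ) :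
    1 / 30 * max (phiLimsup φ (zerothSymbol β u φ))
      (max (phiLimsup φ (firstSymbol β u φ)) (phiLimsup φ (secondSymbol β u φ))) ≤
      essNormZ 1 β (MemBloch 1) u φ := by
  refine le_csInf ⟨_, _, isCompactOpToZygmund_dilate hT le_rfl one_pos, rfl⟩ ?_
  rintro _ ⟨K, hK, rfl⟩
  have h := phiLimsup_symbols_le hu hφ hm hT hK
    (r := sSup {s | ∃ f, MemBloch 1 f ∧ blochNorm 1 f ≤ 1 ∧
      s = zygNorm β (fun z => wcomp u φ f z - K f z)})
    (Real.sSup_nonneg (by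
      rintro _ ⟨f, -, -, rfl⟩
      exact zygNorm_nonneg _ _))
    (fun f hf hn => le_csSup (bddAbove_zygNorm_sub hT hK) ⟨f, hf, hn, rfl⟩)
  linarith

lemma essNormZ_le_of_dilate {r X : ℝ} (hT : BoundedBlochToZygmund 1 β u φ) (hr : 0 ≤ r)
    (hr1 : r < 1) (hX : 0 ≤ X) (h : ∀ f, MemBloch 1 f → blochNorm 1 f ≤ 1 →
      zygNorm β (wcomp u φ (fun z => f z - dilate r f z)) ≤ X) :
    essNormZ 1 β (MemBloch 1) u φ ≤ X := by
  have h1 : essNormZ 1 β (MemBloch 1) u φ ≤ sSup {s | ∃ f, MemBloch 1 f ∧ blochNorm 1 f ≤ 1 ∧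
      s = zygNorm β (fun z => wcomp u φ f z - wcomp u φ (dilate r f) z)} := by
    refine csInf_le ⟨0, ?_⟩ ⟨_, isCompactOpToZygmund_dilate hT hr hr1, rfl⟩
    rintro _ ⟨K, -, rfl⟩
    apply Real.sSup_nonneg
    rintro _ ⟨f, -, -, rfl⟩
    exact zygNorm_nonneg _ _
  refine h1.trans (Real.sSup_le ?_ hX)
  rintro _ ⟨f, hf, hn, rfl⟩
  rw [wcomp_sub]
  exact h f hf hn

lemma sub_dilate_growth {r : ℝ} {w : ℂ} (hf : MemBloch 1 f) (hn : blochNorm 1 f ≤ 1)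
    (hr : 0 ≤ r) (hr1 : r ≤ 1) (hw : w ∈ unitDisk) :
    ‖f w - dilate r f w‖ ≤ 4 * Real.log (Real.exp 1 / (1 - ‖w‖ ^ 2)) ∧
    ‖deriv (fun z => f z - dilate r f z) w‖ ≤ 2 / (1 - ‖w‖ ^ 2) ∧
    ‖deriv (deriv (fun z => f z - dilate r f z)) w‖ ≤ 32 / (1 - ‖w‖ ^ 2) ^ 2 := by
  have hf' := hf.dilate hr hr1
  have hn' := (blochNorm_dilate_le hf hr hr1).trans hn
  rw [deriv_sub_of_mem hf.1 hf'.1 hw, deriv_deriv_sub_of_mem hf.1 hf'.1 hw]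
  refine ⟨?_, ?_, ?_⟩
  · linarith [norm_sub_le (f w) (dilate r f w), norm_le_log_of_blochNorm_le_one hf hn hw,
      norm_le_log_of_blochNorm_le_one hf' hn' hw]
  · have h : 2 / (1 - ‖w‖ ^ 2) = 1 / (1 - ‖w‖ ^ 2) + 1 / (1 - ‖w‖ ^ 2) := by ring
    linarith [norm_sub_le (deriv f w) (deriv (dilate r f) w), hf.norm_deriv_le hn hw,
      hf'.norm_deriv_le hn' hw]
  · have h : 32 / (1 - ‖w‖ ^ 2) ^ 2 = 16 / (1 - ‖w‖ ^ 2) ^ 2 + 16 / (1 - ‖w‖ ^ 2) ^ 2 := by ring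
    linarith [norm_sub_le (deriv (deriv f) w) (deriv (deriv (dilate r f)) w),
      norm_deriv_deriv_le_of_blochNorm_le_one hf hn hw,
      norm_deriv_deriv_le_of_blochNorm_le_one hf' hn' hw]

lemma essNormZ_le (hu : DifferentiableOn ℂ u unitDisk) (hφ : DifferentiableOn ℂ φ unitDisk)
    (hm : MapsTo φ unitDisk unitDisk) (hT : BoundedBlochToZygmund 1 β u φ) :
    essNormZ 1 β (MemBloch 1) u φ ≤ 38 * max (phiLimsup φ (zerothSymbol β u φ))
      (max (phiLimsup φ (firstSymbol β u φ)) (phiLimsup φ (secondSymbol β u φ))) := by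
  obtain ⟨M, hM⟩ : ∃ M, M = max (phiLimsup φ (zerothSymbol β u φ))
      (max (phiLimsup φ (firstSymbol β u φ)) (phiLimsup φ (secondSymbol β u φ))) := ⟨_, rfl⟩
  have hM₀ : phiLimsup φ (zerothSymbol β u φ) ≤ M := hM ▸ le_max_left _ _
  have hM₁ : phiLimsup φ (firstSymbol β u φ) ≤ M :=
    hM ▸ (le_max_left _ _).trans (le_max_right _ _)
  have hM₂ : phiLimsup φ (secondSymbol β u φ) ≤ M :=
    hM ▸ (le_max_right _ _).trans (le_max_right _ _)
  have hM0 : 0 ≤ M := (phiLimsup_nonneg fun _ => zerothSymbol_nonneg hm).trans hM₀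
  rw [← hM]
  obtain ⟨A, hA0, hA⟩ := exists_symbols_bound hu hφ hm hT
  refine le_of_forall_pos_le_add fun δ₀ hδ₀ => ?_
  obtain ⟨δ, hδ, rfl⟩ : ∃ δ, 0 < δ ∧ δ₀ = 39 * δ := ⟨δ₀ / 39, by positivity, by ring⟩
  have hev := (eventually_le_of_phiLimsup_lt hm (fun z hz => (hA z hz).1)
    (hM₀.trans_lt (lt_add_of_pos_right M hδ))).and
    ((eventually_le_of_phiLimsup_lt hm (fun z hz => (hA z hz).2.1)
    (hM₁.trans_lt (lt_add_of_pos_right M hδ))).and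
    (eventually_le_of_phiLimsup_lt hm (fun z hz => (hA z hz).2.2)
    (hM₂.trans_lt (lt_add_of_pos_right M hδ))))
  obtain ⟨s, hs, hsym⟩ := (eventually_towardBoundary_iff hm).1 hev
  have hφ0 := hm zero_mem_unitDisk
  obtain ⟨N, hN⟩ : ∃ N, N = 3 * A + ‖u 0‖ + ‖deriv u 0‖ + ‖u 0‖ * ‖deriv φ 0‖ := ⟨_, rfl⟩
  have hN0 : 0 < N := by rw [hN]; positivity
  have hε : 0 < δ / N := by positivity
  obtain ⟨r, hr0, hr1, hclose⟩ := exists_dilate_close (s := max s ‖φ 0‖)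
    (hs.1.trans (le_max_left _ _)) (max_lt hs.2 (mem_unitDisk.1 hφ0)) hε
  refine essNormZ_le_of_dilate hT hr0.le hr1 (by positivity) fun f hf hn => ?_
  have hd : DifferentiableOn ℂ (fun z => f z - dilate r f z) unitDisk :=
    hf.1.sub (hf.dilate hr0.le hr1.le).1
  obtain ⟨ε, hεN⟩ : ∃ ε, ε = δ / N := ⟨_, rfl⟩
  rw [← hεN] at hclose hε
  have hεN' : ε * N = δ := by rw [hεN, div_mul_cancel₀ _ hN0.ne']
  obtain ⟨c₀, c₁, -⟩ := hclose f hf hn (φ 0) (le_max_right _ _)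
  have b₀ : ‖wcomp u φ (fun z => f z - dilate r f z) 0‖ ≤ ε * ‖u 0‖ := by
    rw [wcomp, norm_mul, mul_comm]
    gcongr
  have b₁ : ‖deriv (wcomp u φ (fun z => f z - dilate r f z)) 0‖ ≤
      ε * (‖deriv u 0‖ + ‖u 0‖ * ‖deriv φ 0‖) := by
    rw [(hasDerivAt_wcomp hu hφ hm hd zero_mem_unitDisk).deriv]
    refine (norm_add_le _ _).trans ?_
    rw [norm_mul, norm_mul, norm_mul]
    calc _ ≤ ‖deriv u 0‖ * ε + ‖u 0‖ * (ε * ‖deriv φ 0‖) := by gcongr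
      _ = _ := by ring
  have b₂ : wnorm β (deriv (deriv (wcomp u φ (fun z => f z - dilate r f z)))) ≤
      38 * (M + δ) + 3 * A * ε := by
    refine wnorm_le fun z hz => ?_
    have hw := hm hz
    have hp := one_sub_sq_pos hw
    obtain ⟨a₀, a₁, a₂⟩ := hA z hz
    rcases le_or_gt ‖φ z‖ s with hzs | hzs
    · obtain ⟨d₀, d₁, d₂⟩ := hclose f hf hn (φ z) (hzs.trans (le_max_left _ _))
      have h := weight_mul_deriv_deriv_wcomp_le_symbols (β := β) (a := ε) (b := ε) (c := ε)
        hu hφ hm hd hz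
        (d₀.trans (le_mul_of_one_le_right hε.le (one_le_log_exp_div hw)))
        (d₁.trans (le_div_self hε.le hp (one_sub_sq_le_one _)))
        (d₂.trans (le_div_self hε.le (pow_pos hp 2) (pow_le_one₀ hp.le (one_sub_sq_le_one _))))
      have h1 := mul_le_mul_of_nonneg_left a₀ hε.le
      have h2 := mul_le_mul_of_nonneg_left a₁ hε.le
      have h3 := mul_le_mul_of_nonneg_left a₂ hε.le
      linarith
    · obtain ⟨s₀, s₁, s₂⟩ := hsym z hz hzs
      obtain ⟨g₀, g₁, g₂⟩ := sub_dilate_growth hf hn hr0.le hr1.le hw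
      have h := weight_mul_deriv_deriv_wcomp_le_symbols (β := β) hu hφ hm hd hz g₀ g₁ g₂
      have : 0 < A * ε := mul_pos hA0 hε
      linarith
  have hsum : ε * ‖u 0‖ + ε * (‖deriv u 0‖ + ‖u 0‖ * ‖deriv φ 0‖) + 3 * A * ε = δ := by
    rw [← hεN', hN]
    ring
  unfold zygNorm
  linarith

end EssentialNorm

/-- **Theorem 4.5** (pointwise form). For `uC_φ : B → Z_β` bounded, `‖uC_φ‖_e` is
comparable with the maximum of the three `limsup_{|φ(z)|→1}` quantities (the first with a
logarithmic factor), with constants depending only on `β`. -/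
theorem essNorm_Bloch_to_Zygmund_of_eq_one'
    (β : ℝ) (hβ : 0 < β) :
    ∃ c C : ℝ, 0 < c ∧ 0 < C ∧
      ∀ u φ : ℂ → ℂ, DifferentiableOn ℂ u unitDisk → DifferentiableOn ℂ φ unitDisk →
        Set.MapsTo φ unitDisk unitDisk → BoundedBlochToZygmund 1 β u φ →
        c * max
              (phiLimsup φ (fun z => (1 - ‖z‖ ^ 2) ^ β * ‖deriv (deriv u) z‖ * Real.log (Real.exp 1 / (1 - ‖φ z‖ ^ 2))))
              (max
                (phiLimsup φ (fun z => (1 - ‖z‖ ^ 2) ^ β * ‖2 * deriv u z * deriv φ z + u z * deriv (deriv φ) z‖ / (1 - ‖φ z‖ ^ 2)))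
                (phiLimsup φ (fun z => (1 - ‖z‖ ^ 2) ^ β * (‖u z‖ * ‖deriv φ z‖ ^ 2) / (1 - ‖φ z‖ ^ 2) ^ 2)))
            ≤ essNormZ 1 β (MemBloch 1) u φ ∧
          essNormZ 1 β (MemBloch 1) u φ
            ≤ C * max
                (phiLimsup φ (fun z => (1 - ‖z‖ ^ 2) ^ β * ‖deriv (deriv u) z‖ * Real.log (Real.exp 1 / (1 - ‖φ z‖ ^ 2))))
                (max
                  (phiLimsup φ (fun z => (1 - ‖z‖ ^ 2) ^ β * ‖2 * deriv u z * deriv φ z + u z * deriv (deriv φ) z‖ / (1 - ‖φ z‖ ^ 2)))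
                  (phiLimsup φ (fun z => (1 - ‖z‖ ^ 2) ^ β * (‖u z‖ * ‖deriv φ z‖ ^ 2) / (1 - ‖φ z‖ ^ 2) ^ 2))) := by
  refine ⟨1 / 30, 38, by norm_num, by norm_num, fun u φ hu hφ hm hT => ?_⟩
  exact ⟨le_essNormZ hu hφ hm hT, essNormZ_le hu hφ hm hT⟩

end
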